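/- arXiv:2407.17285 — 3 statements merged into one kernel-verified Lean document; each statement's English description precedes it below -/
import Mathlib

section
/- Let x̄ ∈ F be a feasible point of (MPSC) and assume MPSC-SSOCQ holds at x̄. Then MPSC-ACQ holds at x̄. -/
open Set Filter Topology Metric

noncomputable section

namespace MPSC

abbrev Vec (n : ℕ) := EuclideanSpace ℝ (Fin n)

variable {n m p l : ℕ}

open scoped Classical in
/-- Sum of a function over an index set (finite ambient type). -/
noncomputable def sumOver {α β : Type*} [Fintype α] [AddCommMonoid β]
    (S : Set α) (v : α → β) : β :=
  ∑ a, if a ∈ S then v a else 0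

/-- The feasible set of (MPSC). -/
def Feas (g : Fin m → Vec n → ℝ) (h : Fin p → Vec n → ℝ)
    (G H : Fin l → Vec n → ℝ) : Set (Vec n) :=
  {x | (∀ i, g i x ≤ 0) ∧ (∀ j, h j x = 0) ∧ ∀ k, G k x * H k x = 0}

/-- Index set of active inequality constraints. -/
def Ig (g : Fin m → Vec n → ℝ) (xb : Vec n) : Set (Fin m) := {i | g i xb = 0}

def IG (G H : Fin l → Vec n → ℝ) (xb : Vec n) : Set (Fin l) :=
  {k | G k xb = 0 ∧ H k xb ≠ 0}

def IH (G H : Fin l → Vec n → ℝ) (xb : Vec n) : Set (Fin l) :=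
  {k | G k xb ≠ 0 ∧ H k xb = 0}

def IGH (G H : Fin l → Vec n → ℝ) (xb : Vec n) : Set (Fin l) :=
  {k | G k xb = 0 ∧ H k xb = 0}

/-- (β1, β2) is a disjoint bipartition of I_GH. -/
def Partition (G H : Fin l → Vec n → ℝ) (xb : Vec n) (β1 β2 : Set (Fin l)) : Prop :=
  β1 ∩ β2 = ∅ ∧ β1 ∪ β2 = IGH G H xb

/-- Branch feasible set. -/
def BranchFeas (g : Fin m → Vec n → ℝ) (h : Fin p → Vec n → ℝ)
    (G H : Fin l → Vec n → ℝ) (xb : Vec n) (β1 β2 : Set (Fin l)) : Set (Vec n) :=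
  {x | (∀ i, g i x ≤ 0) ∧ (∀ j, h j x = 0) ∧
    (∀ k ∈ IG G H xb ∪ β1, G k x = 0) ∧ ∀ k ∈ IH G H xb ∪ β2, H k x = 0}

/-- Bouligand tangent cone, as defined in the paper. -/
def tangentCone (Ω : Set (Vec n)) (xb : Vec n) : Set (Vec n) :=
  {d | ∃ t : ℕ → ℝ, ∃ x : ℕ → Vec n, (∀ k, 0 ≤ t k) ∧ (∀ k, x k ∈ Ω) ∧
    Tendsto x atTop (nhds xb) ∧ Tendsto (fun k => t k • (x k - xb)) atTop (nhds d)}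

/-- MPSC linearization cone. -/
def LCone (g : Fin m → Vec n → ℝ) (h : Fin p → Vec n → ℝ)
    (G H : Fin l → Vec n → ℝ) (xb : Vec n) : Set (Vec n) :=
  {d | (∀ i ∈ Ig g xb, fderiv ℝ (g i) xb d ≤ 0) ∧ (∀ j, fderiv ℝ (h j) xb d = 0) ∧
    (∀ k ∈ IG G H xb, fderiv ℝ (G k) xb d = 0) ∧ (∀ k ∈ IH G H xb, fderiv ℝ (H k) xb d = 0) ∧
    ∀ k ∈ IGH G H xb, fderiv ℝ (G k) xb d * fderiv ℝ (H k) xb d = 0}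

/-- Branch linearization cone. -/
def BranchLCone (g : Fin m → Vec n → ℝ) (h : Fin p → Vec n → ℝ)
    (G H : Fin l → Vec n → ℝ) (xb : Vec n) (β1 β2 : Set (Fin l)) : Set (Vec n) :=
  {d | (∀ i ∈ Ig g xb, fderiv ℝ (g i) xb d ≤ 0) ∧ (∀ j, fderiv ℝ (h j) xb d = 0) ∧
    (∀ k ∈ IG G H xb ∪ β1, fderiv ℝ (G k) xb d = 0) ∧
    ∀ k ∈ IH G H xb ∪ β2, fderiv ℝ (H k) xb d = 0}

/-- MPSC critical subspace. -/
def CritSubspace (g : Fin m → Vec n → ℝ) (h : Fin p → Vec n → ℝ)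
    (G H : Fin l → Vec n → ℝ) (xb : Vec n) : Set (Vec n) :=
  {d | (∀ i ∈ Ig g xb, fderiv ℝ (g i) xb d = 0) ∧ (∀ j, fderiv ℝ (h j) xb d = 0) ∧
    (∀ k ∈ IG G H xb ∪ IGH G H xb, fderiv ℝ (G k) xb d = 0) ∧
    ∀ k ∈ IH G H xb ∪ IGH G H xb, fderiv ℝ (H k) xb d = 0}

/-- Rank (dimension of the span) of the family of gradients
{∇g_i(x)}_{i∈I1} ∪ {∇h_j(x)}_j ∪ {∇G_k(x)}_{k∈I3} ∪ {∇H_k(x)}_{k∈I4}. -/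
def gradRank (g : Fin m → Vec n → ℝ) (h : Fin p → Vec n → ℝ)
    (G H : Fin l → Vec n → ℝ) (I1 : Set (Fin m)) (I3 I4 : Set (Fin l)) (x : Vec n) : ℕ :=
  Module.finrank ℝ ↥(Submodule.span ℝ
    ((fun i => gradient (g i) x) '' I1 ∪ Set.range (fun j => gradient (h j) x) ∪
     (fun k => gradient (G k) x) '' I3 ∪ (fun k => gradient (H k) x) '' I4))

/-- MPSC-LICQ. -/
def LICQ (g : Fin m → Vec n → ℝ) (h : Fin p → Vec n → ℝ)
    (G H : Fin l → Vec n → ℝ) (xb : Vec n) : Prop :=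
  ∀ (lam : Fin m → ℝ) (ρ : Fin p → ℝ) (μ ν : Fin l → ℝ),
    (∀ i, i ∉ Ig g xb → lam i = 0) →
    (∀ k, k ∉ IG G H xb ∪ IGH G H xb → μ k = 0) →
    (∀ k, k ∉ IH G H xb ∪ IGH G H xb → ν k = 0) →
    ∑ i, lam i • gradient (g i) xb + ∑ j, ρ j • gradient (h j) xb +
      ∑ k, μ k • gradient (G k) xb + ∑ k, ν k • gradient (H k) xb = 0 →
    lam = 0 ∧ ρ = 0 ∧ μ = 0 ∧ ν = 0

/-- MPSC-RCRCQ. -/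
def RCRCQ (g : Fin m → Vec n → ℝ) (h : Fin p → Vec n → ℝ)
    (G H : Fin l → Vec n → ℝ) (xb : Vec n) : Prop :=
  ∃ ε > (0:ℝ), ∀ I1 : Set (Fin m), I1 ⊆ Ig g xb →
    ∀ I3 I4 : Set (Fin l), I3 ⊆ IGH G H xb → I4 ⊆ IGH G H xb →
      ∀ x : Vec n, ‖x - xb‖ < ε →
        gradRank g h G H I1 (I3 ∪ IG G H xb) (I4 ∪ IH G H xb) x =
        gradRank g h G H I1 (I3 ∪ IG G H xb) (I4 ∪ IH G H xb) xb

/-- MPSC-WCR. -/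
def WCR (g : Fin m → Vec n → ℝ) (h : Fin p → Vec n → ℝ)
    (G H : Fin l → Vec n → ℝ) (xb : Vec n) : Prop :=
  ∃ ε > (0:ℝ), ∀ x : Vec n, ‖x - xb‖ < ε →
    gradRank g h G H (Ig g xb) (IG G H xb ∪ IGH G H xb) (IH G H xb ∪ IGH G H xb) x =
    gradRank g h G H (Ig g xb) (IG G H xb ∪ IGH G H xb) (IH G H xb ∪ IGH G H xb) xb

/-- MPSC-PWCR. -/
def PWCR (g : Fin m → Vec n → ℝ) (h : Fin p → Vec n → ℝ)
    (G H : Fin l → Vec n → ℝ) (xb : Vec n) : Prop :=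
  ∀ β1 β2 : Set (Fin l), Partition G H xb β1 β2 →
    ∃ ε > (0:ℝ), ∀ x : Vec n, ‖x - xb‖ < ε →
      gradRank g h G H (Ig g xb) (IG G H xb ∪ β1) (IH G H xb ∪ β2) x =
      gradRank g h G H (Ig g xb) (IG G H xb ∪ β1) (IH G H xb ∪ β2) xb

/-- The index set I_g^- associated with a branch (β1, β2). -/
def IgMinus (g : Fin m → Vec n → ℝ) (h : Fin p → Vec n → ℝ)
    (G H : Fin l → Vec n → ℝ) (xb : Vec n) (β1 β2 : Set (Fin l)) : Set (Fin m) :=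
  {i | i ∈ Ig g xb ∧ ∃ (lam : Fin m → ℝ) (ρ : Fin p → ℝ) (μ ν : Fin l → ℝ),
    (∀ i', 0 ≤ lam i') ∧ (∀ i', i' ∉ Ig g xb \ {i} → lam i' = 0) ∧
    (∀ k, k ∉ IG G H xb ∪ β1 → μ k = 0) ∧ (∀ k, k ∉ IH G H xb ∪ β2 → ν k = 0) ∧
    -gradient (g i) xb = ∑ i', lam i' • gradient (g i') xb + ∑ j, ρ j • gradient (h j) xb +
      ∑ k, μ k • gradient (G k) xb + ∑ k, ν k • gradient (H k) xb}

/-- MPSC-PCRSC. -/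
def PCRSC (g : Fin m → Vec n → ℝ) (h : Fin p → Vec n → ℝ)
    (G H : Fin l → Vec n → ℝ) (xb : Vec n) : Prop :=
  ∀ β1 β2 : Set (Fin l), Partition G H xb β1 β2 →
    ∃ ε > (0:ℝ), ∀ x : Vec n, ‖x - xb‖ < ε →
      gradRank g h G H (IgMinus g h G H xb β1 β2) (IG G H xb ∪ β1) (IH G H xb ∪ β2) x =
      gradRank g h G H (IgMinus g h G H xb β1 β2) (IG G H xb ∪ β1) (IH G H xb ∪ β2) xb

/-- A twice differentiable arc on [0, δ) (one-sided at the endpoint 0),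
with first derivative ξ'. -/
def TwiceDiffArc (δ : ℝ) (ξ ξ' : ℝ → Vec n) : Prop :=
  (∀ t ∈ Ico (0:ℝ) δ, HasDerivWithinAt ξ (ξ' t) (Ico (0:ℝ) δ) t) ∧
  ∀ t ∈ Ico (0:ℝ) δ, DifferentiableWithinAt ℝ ξ' (Ico (0:ℝ) δ) t

/-- MPSC-SSOCQ. -/
def SSOCQ (g : Fin m → Vec n → ℝ) (h : Fin p → Vec n → ℝ)
    (G H : Fin l → Vec n → ℝ) (xb : Vec n) : Prop :=
  ∀ d ∈ LCone g h G H xb, d ≠ 0 →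
    ∃ δ > (0:ℝ), ∃ J K : Set (Fin l), J ⊆ IGH G H xb ∧ K ⊆ IGH G H xb ∧
      ∃ ξ ξ' : ℝ → Vec n, TwiceDiffArc δ ξ ξ' ∧
        (∀ t ∈ Ico (0:ℝ) δ, ξ t ∈ Feas g h G H) ∧
        ξ 0 = xb ∧ ξ' 0 = d ∧
        (∀ t ∈ Ico (0:ℝ) δ, ∀ i ∈ Ig g xb, fderiv ℝ (g i) xb d = 0 → g i (ξ t) = 0) ∧
        (∀ t ∈ Ico (0:ℝ) δ, ∀ k ∈ IG G H xb ∪ J, G k (ξ t) = 0) ∧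
        ∀ t ∈ Ico (0:ℝ) δ, ∀ k ∈ IH G H xb ∪ K, H k (ξ t) = 0

/-- MPSC-WSOCQ. -/
def WSOCQ (g : Fin m → Vec n → ℝ) (h : Fin p → Vec n → ℝ)
    (G H : Fin l → Vec n → ℝ) (xb : Vec n) : Prop :=
  ∀ d ∈ CritSubspace g h G H xb, d ≠ 0 →
    ∃ δ > (0:ℝ), ∃ J K : Set (Fin l), J ⊆ IGH G H xb ∧ K ⊆ IGH G H xb ∧
      ∃ ζ ζ' : ℝ → Vec n, TwiceDiffArc δ ζ ζ' ∧
        (∀ t ∈ Ico (0:ℝ) δ, ζ t ∈ Feas g h G H) ∧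
        ζ 0 = xb ∧ ζ' 0 = d ∧
        (∀ t ∈ Ico (0:ℝ) δ, ∀ i ∈ Ig g xb, g i (ζ t) = 0) ∧
        (∀ t ∈ Ico (0:ℝ) δ, ∀ k ∈ IG G H xb ∪ J, G k (ζ t) = 0) ∧
        ∀ t ∈ Ico (0:ℝ) δ, ∀ k ∈ IH G H xb ∪ K, H k (ζ t) = 0

/-- The S-stationarity system for multipliers (λ, ρ, μ, ν) at xb. -/
def SStationarySystem (f : Vec n → ℝ) (g : Fin m → Vec n → ℝ) (h : Fin p → Vec n → ℝ)
    (G H : Fin l → Vec n → ℝ) (xb : Vec n)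
    (lam : Fin m → ℝ) (ρ : Fin p → ℝ) (μ ν : Fin l → ℝ) : Prop :=
  (∀ i, 0 ≤ lam i) ∧ (∀ i, lam i * g i xb = 0) ∧
  (∀ k ∈ IH G H xb ∪ IGH G H xb, μ k = 0) ∧
  (∀ k ∈ IG G H xb ∪ IGH G H xb, ν k = 0) ∧
  gradient f xb + ∑ i, lam i • gradient (g i) xb + ∑ j, ρ j • gradient (h j) xb +
    ∑ k, μ k • gradient (G k) xb + ∑ k, ν k • gradient (H k) xb = 0

def SStationary (f : Vec n → ℝ) (g : Fin m → Vec n → ℝ) (h : Fin p → Vec n → ℝ)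
    (G H : Fin l → Vec n → ℝ) (xb : Vec n) : Prop :=
  ∃ (lam : Fin m → ℝ) (ρ : Fin p → ℝ) (μ ν : Fin l → ℝ),
    SStationarySystem f g h G H xb lam ρ μ ν

/-- The M-stationarity system for multipliers (λ, ρ, μ, ν) at xb. -/
def MStationarySystem (f : Vec n → ℝ) (g : Fin m → Vec n → ℝ) (h : Fin p → Vec n → ℝ)
    (G H : Fin l → Vec n → ℝ) (xb : Vec n)
    (lam : Fin m → ℝ) (ρ : Fin p → ℝ) (μ ν : Fin l → ℝ) : Prop :=
  (∀ i, 0 ≤ lam i) ∧ (∀ i, lam i * g i xb = 0) ∧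
  (∀ k ∈ IH G H xb, μ k = 0) ∧ (∀ k ∈ IG G H xb, ν k = 0) ∧
  (∀ k ∈ IGH G H xb, μ k * ν k = 0) ∧
  gradient f xb + ∑ i, lam i • gradient (g i) xb + ∑ j, ρ j • gradient (h j) xb +
    ∑ k, μ k • gradient (G k) xb + ∑ k, ν k • gradient (H k) xb = 0

def MStationary (f : Vec n → ℝ) (g : Fin m → Vec n → ℝ) (h : Fin p → Vec n → ℝ)
    (G H : Fin l → Vec n → ℝ) (xb : Vec n) : Prop :=
  ∃ (lam : Fin m → ℝ) (ρ : Fin p → ℝ) (μ ν : Fin l → ℝ),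
    MStationarySystem f g h G H xb lam ρ μ ν

/-- Local optimality for (MPSC). -/
def LocallyOptimal (f : Vec n → ℝ) (g : Fin m → Vec n → ℝ) (h : Fin p → Vec n → ℝ)
    (G H : Fin l → Vec n → ℝ) (xb : Vec n) : Prop :=
  xb ∈ Feas g h G H ∧ ∃ ε > (0:ℝ), ∀ x ∈ Feas g h G H, ‖x - xb‖ < ε → f xb ≤ f x

/-- Hessian quadratic form dᵀ∇²φ(x)d. -/
def hessForm (φ : Vec n → ℝ) (x d : Vec n) : ℝ :=
  iteratedFDeriv ℝ 2 φ x ![d, d]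

/-- The Lagrange function ℓ. -/
def lagr (f : Vec n → ℝ) (g : Fin m → Vec n → ℝ) (h : Fin p → Vec n → ℝ)
    (G H : Fin l → Vec n → ℝ)
    (lam : Fin m → ℝ) (ρ : Fin p → ℝ) (μ ν : Fin l → ℝ) : Vec n → ℝ :=
  fun x => f x + ∑ i, lam i * g i x + ∑ j, ρ j * h j x +
    ∑ k, μ k * G k x + ∑ k, ν k * H k x

/-- Constraint-violation residual. -/
def residual (g : Fin m → Vec n → ℝ) (h : Fin p → Vec n → ℝ)
    (G H : Fin l → Vec n → ℝ) (x : Vec n) : ℝ :=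
  Real.sqrt (∑ i, max (g i x) 0 ^ 2 + ∑ j, h j x ^ 2 + ∑ k, min (G k x ^ 2) (H k x ^ 2))

/-- Penalty function P_κ. -/
def Pen (f : Vec n → ℝ) (g : Fin m → Vec n → ℝ) (h : Fin p → Vec n → ℝ)
    (G H : Fin l → Vec n → ℝ) (κ : ℝ) (x : Vec n) : ℝ :=
  f x + κ * residual g h G H x

/-- MPSC piecewise second-order quasi-normality. -/
def PSOQN (g : Fin m → Vec n → ℝ) (h : Fin p → Vec n → ℝ)
    (G H : Fin l → Vec n → ℝ) (xb : Vec n) : Prop :=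
  ∀ β1 β2 : Set (Fin l), Partition G H xb β1 β2 →
    ¬ ∃ (lam : Fin m → ℝ) (ρ : Fin p → ℝ) (μ ν : Fin l → ℝ),
      (∀ i, 0 ≤ lam i) ∧
      (∀ k, k ∉ IG G H xb ∪ β1 → μ k = 0) ∧ (∀ k, k ∉ IH G H xb ∪ β2 → ν k = 0) ∧
      ¬(lam = 0 ∧ ρ = 0 ∧ μ = 0 ∧ ν = 0) ∧
      (∑ i, lam i • gradient (g i) xb + ∑ j, ρ j • gradient (h j) xb +
        ∑ k, μ k • gradient (G k) xb + ∑ k, ν k • gradient (H k) xb = 0) ∧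
      (∀ d : Vec n, (∀ i ∈ Ig g xb, fderiv ℝ (g i) xb d = 0) →
        (∀ j, fderiv ℝ (h j) xb d = 0) →
        (∀ k ∈ IG G H xb ∪ β1, fderiv ℝ (G k) xb d = 0) →
        (∀ k ∈ IH G H xb ∪ β2, fderiv ℝ (H k) xb d = 0) →
        0 ≤ ∑ i, lam i * hessForm (g i) xb d + ∑ j, ρ j * hessForm (h j) xb d +
          ∑ k, μ k * hessForm (G k) xb d + ∑ k, ν k * hessForm (H k) xb d) ∧
      ∃ xs : ℕ → Vec n, Tendsto xs atTop (nhds xb) ∧ ∀ s,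
        (∀ i, 0 < lam i → 0 < lam i * g i (xs s)) ∧
        (∀ j, ρ j ≠ 0 → 0 < ρ j * h j (xs s)) ∧
        (∀ k, μ k ≠ 0 → 0 < μ k * G k (xs s)) ∧
        (∀ k, ν k ≠ 0 → 0 < ν k * H k (xs s))

theorem mem_tangentCone_self {Ω : Set (Vec n)} {x : Vec n} (hx : x ∈ Ω) :
    (0 : Vec n) ∈ tangentCone Ω x :=
  ⟨fun _ => 0, fun _ => x, fun _ => le_rfl, fun _ => hx, tendsto_const_nhds, by simp⟩

/-- The right derivative at `0` of an arc in `Ω` is tangent to `Ω`. -/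
theorem mem_tangentCone_of_arc {Ω : Set (Vec n)} {δ : ℝ} (hδ : 0 < δ) {ξ : ℝ → Vec n}
    {d : Vec n} (hξ : HasDerivWithinAt ξ d (Ico 0 δ) 0) (hΩ : ∀ t ∈ Ico (0 : ℝ) δ, ξ t ∈ Ω) :
    d ∈ tangentCone Ω (ξ 0) := by
  set s : ℕ → ℝ := fun k => δ / ((k : ℝ) + 2) with hs
  have hpos : ∀ k, 0 < s k := fun k => by positivity
  have hmem : ∀ k, s k ∈ Ico (0 : ℝ) δ := fun k =>
    ⟨(hpos k).le, div_lt_self hδ (by have := k.cast_nonneg (α := ℝ); linarith)⟩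
  have hs0 : Tendsto s atTop (𝓝 0) :=
    (tendsto_atTop_add_const_right _ 2 tendsto_natCast_atTop_atTop).const_div_atTop δ
  refine ⟨fun k => (s k)⁻¹, fun k => ξ (s k), fun k => (inv_pos.2 (hpos k)).le,
    fun k => hΩ _ (hmem k), ?_, ?_⟩
  · exact hξ.continuousWithinAt.tendsto.comp
      (tendsto_nhdsWithin_iff.2 ⟨hs0, Eventually.of_forall hmem⟩)
  · have hone : Tendsto (fun k => (s k)⁻¹ • s k) atTop (𝓝 (1 : ℝ)) := by
      simp [inv_mul_cancel₀ (hpos _).ne']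
    simpa using hξ.hasFDerivWithinAt.lim hs0
      (Eventually.of_forall fun k => by simpa using hmem k) hone

/-- First-order expansion of a differentiable function along a tangent sequence. -/
theorem tendsto_mul_of_tangent_seq {φ : Vec n → ℝ} {xb d : Vec n} (hφ : DifferentiableAt ℝ φ xb)
    (h0 : φ xb = 0) {t : ℕ → ℝ} {x : ℕ → Vec n} (hx : Tendsto x atTop (𝓝 xb))
    (hd : Tendsto (fun k => t k • (x k - xb)) atTop (𝓝 d)) :
    Tendsto (fun k => t k * φ (x k)) atTop (𝓝 (fderiv ℝ φ xb d)) := by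
  simpa [h0] using hφ.hasFDerivAt.hasFDerivWithinAt.lim (tendsto_sub_nhds_zero_iff.2 hx)
    (Eventually.of_forall fun _ => mem_univ _) hd

theorem fderiv_eq_zero_of_mul_eq_zero {φ ψ : Vec n → ℝ} {xb d : Vec n}
    (hφ : DifferentiableAt ℝ φ xb) (hψ : ContinuousAt ψ xb) (h0 : φ xb = 0) (hne : ψ xb ≠ 0)
    {t : ℕ → ℝ} {x : ℕ → Vec n} (hx : Tendsto x atTop (𝓝 xb))
    (hd : Tendsto (fun k => t k • (x k - xb)) atTop (𝓝 d))
    (hmul : ∀ k, φ (x k) * ψ (x k) = 0) : fderiv ℝ φ xb d = 0 := by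
  refine tendsto_nhds_unique (tendsto_mul_of_tangent_seq hφ h0 hx hd)
    (tendsto_const_nhds.congr' ?_)
  filter_upwards [(hψ.tendsto.comp hx).eventually_ne hne] with k hk
  rw [(mul_eq_zero.1 (hmul k)).resolve_right hk, mul_zero]

theorem tangentCone_subset_LCone {g : Fin m → Vec n → ℝ} {h : Fin p → Vec n → ℝ}
    {G H : Fin l → Vec n → ℝ} {xb : Vec n}
    (hg : ∀ i, DifferentiableAt ℝ (g i) xb) (hh : ∀ j, DifferentiableAt ℝ (h j) xb)
    (hG : ∀ k, DifferentiableAt ℝ (G k) xb) (hH : ∀ k, DifferentiableAt ℝ (H k) xb)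
    (hxb : xb ∈ Feas g h G H) :
    tangentCone (Feas g h G H) xb ⊆ LCone g h G H xb := by
  rintro d ⟨t, x, ht, hxF, hx, hd⟩
  refine ⟨fun i hi => ?_, fun j => ?_, fun k hk => ?_, fun k hk => ?_, fun k hk => ?_⟩
  · exact le_of_tendsto' (tendsto_mul_of_tangent_seq (hg i) hi hx hd) fun s =>
      mul_nonpos_of_nonneg_of_nonpos (ht s) ((hxF s).1 i)
  · refine tendsto_nhds_unique (tendsto_mul_of_tangent_seq (hh j) (hxb.2.1 j) hx hd) ?_
    simp [(hxF _).2.1 j]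
  · exact fderiv_eq_zero_of_mul_eq_zero (hG k) (hH k).continuousAt hk.1 hk.2 hx hd
      fun s => (hxF s).2.2 k
  · exact fderiv_eq_zero_of_mul_eq_zero (hH k) (hG k).continuousAt hk.2 hk.1 hx hd
      fun s => by rw [mul_comm]; exact (hxF s).2.2 k
  · refine tendsto_nhds_unique ((tendsto_mul_of_tangent_seq (hG k) hk.1 hx hd).mul
      (tendsto_mul_of_tangent_seq (hH k) hk.2 hx hd)) (tendsto_const_nhds.congr fun s => ?_)
    rw [mul_mul_mul_comm, (hxF s).2.2 k, mul_zero]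

theorem ssocq_implies_acq {n m p l : ℕ} (f : Vec n → ℝ) (g : Fin m → Vec n → ℝ)
    (h : Fin p → Vec n → ℝ) (G H : Fin l → Vec n → ℝ)
    (hf : ContDiff ℝ 2 f) (hg : ∀ i, ContDiff ℝ 2 (g i)) (hh : ∀ j, ContDiff ℝ 2 (h j))
    (hG : ∀ k, ContDiff ℝ 2 (G k)) (hH : ∀ k, ContDiff ℝ 2 (H k))
    (xb : Vec n) (hxb : xb ∈ Feas g h G H)
    (hcq : SSOCQ g h G H xb) :
    tangentCone (Feas g h G H) xb = LCone g h G H xb := by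
  have hdiff : ∀ {φ : Vec n → ℝ}, ContDiff ℝ 2 φ → DifferentiableAt ℝ φ xb :=
    fun hφ => (hφ.differentiable two_ne_zero).differentiableAt
  refine Subset.antisymm (tangentCone_subset_LCone (fun i => hdiff (hg i))
    (fun j => hdiff (hh j)) (fun k => hdiff (hG k)) (fun k => hdiff (hH k)) hxb) fun d hd => ?_
  rcases eq_or_ne d 0 with rfl | hne
  · exact mem_tangentCone_self hxb
  · obtain ⟨δ, hδ, -, -, -, -, ξ, ξ', harc, hF, rfl, rfl, -⟩ := hcq d hd hne
    exact mem_tangentCone_of_arc hδ (harc.1 0 ⟨le_rfl, hδ⟩) hF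

end MPSC
end
end

section
/- Let x̄ ∈ F be a feasible point of (MPSC) and assume MPSC-PCRSC holds at x̄. Then MPSC-ACQ holds at x̄. -/
open Set Filter Topology Metric

noncomputable section

namespace MPSC

variable {n m p l : ℕ}

theorem farkas {V ι κ : Type*} [AddCommGroup V] [Module ℝ V] [Fintype κ]
    (e : κ → V →ₗ[ℝ] ℝ) (s : Finset ι) (a : ι → V →ₗ[ℝ] ℝ) (b : V →ₗ[ℝ] ℝ)
    (hb : ∀ x, (∀ i ∈ s, 0 ≤ a i x) → (∀ k, e k x = 0) → 0 ≤ b x) :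
    ∃ (c : ι → ℝ) (ρ : κ → ℝ), (∀ i, 0 ≤ c i) ∧
      b = ∑ i ∈ s, c i • a i + ∑ k, ρ k • e k := by
  classical
  induction s using Finset.induction_on generalizing a b with
  | empty =>
    have hker : ⨅ k, LinearMap.ker (e k) ≤ LinearMap.ker b := by
      intro x hx
      simp only [Submodule.mem_iInf, LinearMap.mem_ker] at hx ⊢
      have h1 := hb x (by simp) hx
      have h2 := hb (-x) (by simp) (fun k => by simp [hx k])
      rw [map_neg] at h2
      linarith
    obtain ⟨ρ, hρ⟩ := (Submodule.mem_span_range_iff_exists_fun ℝ).1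
      (mem_span_of_iInf_ker_le_ker hker)
    exact ⟨0, ρ, fun _ => le_rfl, by simp [hρ]⟩
  | insert i s his ih =>
    by_cases hred : ∀ x, (∀ j ∈ s, 0 ≤ a j x) → (∀ k, e k x = 0) → 0 ≤ b x
    · obtain ⟨c, ρ, hc, hb'⟩ := ih a b hred
      refine ⟨Function.update c i 0, ρ, fun j => ?_, ?_⟩
      · by_cases hj : j = i
        · simp [hj]
        · simp [hj, hc j]
      · rw [Finset.sum_insert his, hb']
        simp only [Function.update_self, zero_smul, zero_add]
        congr 1
        refine Finset.sum_congr rfl fun j hj => ?_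
        rw [Function.update_of_ne (ne_of_mem_of_not_mem hj his)]
    · push Not at hred
      obtain ⟨y, hys, hye, hby⟩ := hred
      have hiy : a i y < 0 := by
        by_contra! hcon
        refine absurd (hb y ?_ hye) (not_le.2 hby)
        intro j hj
        rcases Finset.mem_insert.1 hj with rfl | hj
        · exact hcon
        · exact hys j hj
      set r : ℝ := -(a i y)⁻¹ with hr
      have hr0 : 0 < r := by rw [hr]; exact neg_pos.2 (inv_lt_zero.2 hiy)
      have hri : r * a i y = -1 := by rw [hr]; field_simp [hiy.ne]
      obtain ⟨c, ρ, hc, hb'⟩ := ih (fun j => a j + (r * a j y) • a i) (b + (r * b y) • a i) (by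
        intro x hx hex
        have h1 := hb (x + (r * a i x) • y) (by
          intro j hj
          rcases Finset.mem_insert.1 hj with rfl | hj
          · simp only [map_add, map_smul, smul_eq_mul]
            have : a j x + r * a j x * a j y = a j x + a j x * (r * a j y) := by ring
            rw [this, hri]; linarith
          · have := hx j hj
            simp only [LinearMap.add_apply, LinearMap.smul_apply, smul_eq_mul, map_add,
              map_smul] at this ⊢
            linarith) (fun k => by simp [hex k, hye k])
        simp only [LinearMap.add_apply, LinearMap.smul_apply, smul_eq_mul, map_add,
          map_smul] at h1 ⊢
        linarith)
      have hpos : 0 ≤ ∑ j ∈ s, c j * (r * a j y) - r * b y := by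
        have h1 : 0 ≤ ∑ j ∈ s, c j * (r * a j y) := Finset.sum_nonneg fun j hj =>
          mul_nonneg (hc j) (mul_nonneg hr0.le (hys j hj))
        have h2 : r * b y ≤ 0 := mul_nonpos_of_nonneg_of_nonpos hr0.le hby.le
        linarith
      refine ⟨Function.update c i (∑ j ∈ s, c j * (r * a j y) - r * b y), ρ, fun j => ?_, ?_⟩
      · by_cases hj : j = i
        · subst hj; simpa using hpos
        · simp [hj, hc j]
      · have hsum : ∑ j ∈ s, Function.update c i (∑ j ∈ s, c j * (r * a j y) - r * b y) j • a j
            = ∑ j ∈ s, c j • a j := by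
          refine Finset.sum_congr rfl fun j hj => ?_
          rw [Function.update_of_ne (ne_of_mem_of_not_mem hj his)]
        rw [Finset.sum_insert his, hsum, Function.update_self]
        refine LinearMap.ext fun x => ?_
        have hx := LinearMap.congr_fun hb' x
        simp only [LinearMap.add_apply, LinearMap.sum_apply, LinearMap.smul_apply, smul_eq_mul,
          mul_add, Finset.sum_add_distrib, ← mul_assoc, ← Finset.sum_mul] at hx ⊢
        rw [sub_mul]
        linarith

theorem inner_gradient {E : Type*} [NormedAddCommGroup E] [InnerProductSpace ℝ E]
    [CompleteSpace E] (φ : E → ℝ) (x d : E) :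
    inner ℝ (gradient φ x) d = fderiv ℝ φ x d := by
  simp [gradient]

theorem continuous_gradient {E : Type*} [NormedAddCommGroup E] [InnerProductSpace ℝ E]
    [CompleteSpace E] {φ : E → ℝ} (hφ : ContDiff ℝ 1 φ) :
    Continuous (gradient φ) :=
  (InnerProductSpace.toDual ℝ E).symm.continuous.comp (hφ.continuous_fderiv one_ne_zero)

/-- A finite linearly independent family admits a biorthogonal family. -/
theorem exists_biorthogonal {E κ : Type*} [NormedAddCommGroup E] [InnerProductSpace ℝ E]
    [Finite κ] [DecidableEq κ] {v : κ → E} (hv : LinearIndependent ℝ v) :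
    ∃ w : κ → E, ∀ j k, inner ℝ (v j) (w k) = if j = k then 1 else 0 := by
  have hli : LinearIndependent ℝ (fun k => innerₗ E (v k)) :=
    hv.map' (innerₗ E) (LinearMap.ker_eq_bot'.2 fun x hx => by
      have := LinearMap.congr_fun hx x
      simpa using this)
  have key : ∀ k, ∃ y : E, ∀ j, inner ℝ (v j) y = if j = k then 1 else 0 := by
    intro k
    have hk : ¬ (⨅ j : {j // j ≠ k}, LinearMap.ker (innerₗ E (v j)) ≤
        LinearMap.ker (innerₗ E (v k))) := by
      intro hle
      have hmem := mem_span_of_iInf_ker_le_ker hle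
      refine hli.notMem_span_image (s := {j | j ≠ k}) (x := k) (by simp) ?_
      rwa [Set.image_eq_range]
    obtain ⟨x, hx, hxk⟩ := SetLike.not_le_iff_exists.1 hk
    simp only [Submodule.mem_iInf, LinearMap.mem_ker, innerₗ_apply_apply, Subtype.forall] at hx hxk
    refine ⟨(inner ℝ (v k) x)⁻¹ • x, fun j => ?_⟩
    rw [inner_smul_right]
    split_ifs with hj
    · subst hj; exact inv_mul_cancel₀ hxk
    · rw [hx j hj, mul_zero]
  choose w hw using key
  exact ⟨w, fun j k => hw k j⟩

/-- A system of equations whose gradients have locally constant rank admits, through any solution,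
a curve of solutions with prescribed velocity in the common kernel of the derivatives. -/
theorem exists_curve_of_rank_const {E ι : Type*} [NormedAddCommGroup E] [InnerProductSpace ℝ E]
    [FiniteDimensional ℝ E] [Finite ι] {φ : ι → E → ℝ} (hφ : ∀ i, ContDiff ℝ 1 (φ i)) {a d : E}
    (hrank : ∀ᶠ x in 𝓝 a,
      Module.finrank ℝ (Submodule.span ℝ (range fun i => gradient (φ i) x)) =
        Module.finrank ℝ (Submodule.span ℝ (range fun i => gradient (φ i) a)))
    (ha : ∀ i, φ i a = 0) (hd : ∀ i, fderiv ℝ (φ i) a d = 0) :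
    ∃ ξ : ℝ → E, ξ 0 = a ∧ HasDerivAt ξ d 0 ∧ ∀ᶠ t in 𝓝 0, ∀ i, φ i (ξ t) = 0 := by
  classical
  obtain ⟨κ, s, hs, hspan, hli⟩ := exists_linearIndependent' ℝ (fun i => gradient (φ i) a)
  have : Finite κ := Finite.of_injective s hs
  have := Fintype.ofFinite κ
  obtain ⟨w, hw⟩ := exists_biorthogonal hli
  have hdiff : ∀ i x, DifferentiableAt ℝ (φ i) x := fun i x =>
    (hφ i).differentiable one_ne_zero x
  let F : E → E := fun x => x + ∑ k, (φ (s k) x - fderiv ℝ (φ (s k)) a (x - a)) • w k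
  have hFc : ContDiff ℝ 1 F := by
    refine contDiff_id.add (ContDiff.sum fun k _ => ContDiff.smul (ContDiff.sub (hφ _) ?_)
      contDiff_const)
    exact (fderiv ℝ (φ (s k)) a).contDiff.comp (contDiff_id.sub contDiff_const)
  have hFa : F a = a := by simp [F, ha]
  have hF' : HasFDerivAt F ((ContinuousLinearEquiv.refl ℝ E : E ≃L[ℝ] E) : E →L[ℝ] E) a := by
    have h1 : ∀ k, HasFDerivAt
        (fun x => (φ (s k) x - fderiv ℝ (φ (s k)) a (x - a)) • w k) (0 : E →L[ℝ] E) a := by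
      intro k
      have h2 := ((hdiff (s k) a).hasFDerivAt.sub
        ((fderiv ℝ (φ (s k)) a).hasFDerivAt.comp a ((hasFDerivAt_id a).sub_const a))).smul_const
          (w k)
      convert! h2 using 1
      ext x
      simp
    have h3 := (hasFDerivAt_id (𝕜 := ℝ) a).add (HasFDerivAt.sum fun k (_ : k ∈ Finset.univ) => h1 k)
    convert! h3 using 1
    · ext x
      simp [F]
    · ext x
      simp
  have hFinner : ∀ j x, inner ℝ (gradient (φ (s j)) a) (F x - a) = φ (s j) x := by
    intro j x
    have h1 : F x - a = (x - a) +
        ∑ k, (φ (s k) x - fderiv ℝ (φ (s k)) a (x - a)) • w k := by simp only [F]; abel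
    have h2 : ∀ k, inner ℝ (gradient (φ (s j)) a) (w k) = if j = k then (1 : ℝ) else 0 :=
      fun k => hw j k
    rw [h1, inner_add_right, inner_sum]
    simp [inner_smul_right, h2]
  have hFat := hFc.contDiffAt (x := a)
  let ψ := hFat.localInverse hF' one_ne_zero
  have hψc : ContDiffAt ℝ 1 ψ a := by
    have := hFat.to_localInverse hF' one_ne_zero
    rwa [hFa] at this
  have hψa : ψ a = a := by
    have := hFat.localInverse_apply_image hF' one_ne_zero
    rwa [hFa] at this
  have hψF : ∀ᶠ y in 𝓝 a, F (ψ y) = y := by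
    have := (hFat.hasStrictFDerivAt' hF' one_ne_zero).eventually_right_inverse
    rwa [hFa] at this
  have hψd : HasFDerivAt ψ (ContinuousLinearMap.id ℝ E) a := by
    have := (hFat.hasStrictFDerivAt' hF' one_ne_zero).to_localInverse.hasFDerivAt
    rw [hFa] at this
    exact this
  let ℓ : ℝ → E := fun t => a + t • d
  have hℓ0 : ℓ 0 = a := by simp [ℓ]
  have hℓd : ∀ t, HasDerivAt ℓ d t := fun t => by
    simpa [ℓ] using ((hasDerivAt_id t).smul_const d).const_add a
  have hℓt : Tendsto ℓ (𝓝 0) (𝓝 a) := by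
    simpa [hℓ0] using (hℓd 0).continuousAt.tendsto
  have hξt : Tendsto (fun t => ψ (ℓ t)) (𝓝 0) (𝓝 a) := by
    have := hψc.continuousAt.tendsto.comp hℓt
    rwa [hψa] at this
  refine ⟨fun t => ψ (ℓ t), by simp [hℓ0, hψa], ?_, ?_⟩
  · have h1 : HasFDerivAt ψ (ContinuousLinearMap.id ℝ E) (ℓ 0) := by rwa [hℓ0]
    exact h1.comp_hasDerivAt 0 (hℓd 0)
  have hbasic : ∀ᶠ t in 𝓝 (0 : ℝ), ∀ k, φ (s k) (ψ (ℓ t)) = 0 := by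
    filter_upwards [hℓt.eventually hψF] with t ht k
    rw [← hFinner, ht]
    simp [ℓ, inner_smul_right, hd]
  have hliev : ∀ᶠ x in 𝓝 a, LinearIndependent ℝ (fun k => gradient (φ (s k)) x) := by
    have hcont : Continuous fun x => fun k => gradient (φ (s k)) x :=
      continuous_pi fun k => continuous_gradient (hφ _)
    exact (hcont.tendsto a).eventually hli.eventually
  have hspanev : ∀ᶠ x in 𝓝 a, ∀ i, gradient (φ i) x ∈
      Submodule.span ℝ (range fun k => gradient (φ (s k)) x) := by
    filter_upwards [hliev, hrank] with x hx hr i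
    have hle : Submodule.span ℝ (range fun k => gradient (φ (s k)) x) ≤
        Submodule.span ℝ (range fun i => gradient (φ i) x) :=
      Submodule.span_mono (range_comp_subset_range s fun i => gradient (φ i) x)
    rw [Submodule.eq_of_le_of_finrank_eq hle
      (by rw [hr, ← hspan, finrank_span_eq_card hx, finrank_span_eq_card hli])]
    exact Submodule.subset_span ⟨i, rfl⟩
  have hψdiff : ∀ᶠ y in 𝓝 a, DifferentiableAt ℝ ψ y := by
    filter_upwards [hψc.eventually (by simp)] with y hy
    exact hy.differentiableAt one_ne_zero
  have hderiv : ∀ᶠ t in 𝓝 (0 : ℝ), ∀ i, HasDerivAt (fun t => φ i (ψ (ℓ t))) 0 t := by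
    filter_upwards [hbasic.eventually_nhds, hξt.eventually hspanev, hℓt.eventually hψdiff]
      with t hb hsp hdif i
    have hξ := hdif.hasFDerivAt.comp_hasDerivAt t (hℓd t)
    set v := fderiv ℝ ψ (ℓ t) d with hv
    have hφξ : ∀ i, HasDerivAt (fun t => φ i (ψ (ℓ t))) (inner ℝ (gradient (φ i) (ψ (ℓ t))) v) t :=
      fun i => by
        rw [inner_gradient]
        exact (hdiff i _).hasFDerivAt.comp_hasDerivAt t hξ
    have hzero : ∀ k, inner ℝ (gradient (φ (s k)) (ψ (ℓ t))) v = 0 := fun k => by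
      refine (hφξ (s k)).unique ((hasDerivAt_const t (0 : ℝ)).congr_of_eventuallyEq ?_)
      filter_upwards [hb] with u hu using hu k
    have hvi : inner ℝ (gradient (φ i) (ψ (ℓ t))) v = 0 := by
      have hi := hsp i
      generalize gradient (φ i) (ψ (ℓ t)) = z at hi ⊢
      induction hi using Submodule.span_induction with
      | mem x hx => obtain ⟨k, rfl⟩ := hx; exact hzero k
      | zero => simp
      | add x y _ _ hx hy => rw [inner_add_left, hx, hy, add_zero]
      | smul r x _ hx => rw [inner_smul_left, hx, mul_zero]
    rw [← hvi]
    exact hφξ i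
  obtain ⟨δ, hδ, hball⟩ := Metric.eventually_nhds_iff_ball.1 hderiv
  filter_upwards [Metric.ball_mem_nhds (0 : ℝ) hδ] with t ht i
  have hc := Metric.isOpen_ball.is_const_of_deriv_eq_zero
    (convex_ball (0 : ℝ) δ).isPreconnected
    (fun u hu => ((hball u hu i).differentiableAt).differentiableWithinAt)
    (fun u hu => (hball u hu i).deriv) ht (Metric.mem_ball_self hδ)
  simpa [hℓ0, hψa, ha] using hc

theorem mem_tangentCone_of_forall_approx {n : ℕ} {Ω : Set (Vec n)} {a d : Vec n}
    (hd : ∀ ε > (0 : ℝ), ∃ t : ℝ, 0 ≤ t ∧ ∃ x ∈ Ω, ‖x - a‖ < ε ∧ ‖t • (x - a) - d‖ < ε) :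
    d ∈ tangentCone Ω a := by
  choose t ht x hx hxa hxd using fun k : ℕ => hd (1 / ((k : ℝ) + 1)) (by positivity)
  refine ⟨t, x, ht, hx, ?_, ?_⟩
  · rw [tendsto_iff_norm_sub_tendsto_zero]
    exact squeeze_zero (fun _ => norm_nonneg _) (fun k => (hxa k).le)
      tendsto_one_div_add_atTop_nhds_zero_nat
  · rw [tendsto_iff_norm_sub_tendsto_zero]
    exact squeeze_zero (fun _ => norm_nonneg _) (fun k => (hxd k).le)
      tendsto_one_div_add_atTop_nhds_zero_nat

theorem tendsto_mul_sub_of_tendsto_smul_sub {E : Type*} [NormedAddCommGroup E] [NormedSpace ℝ E]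
    {φ : E → ℝ} {a d : E} (hφ : DifferentiableAt ℝ φ a) {t : ℕ → ℝ} {x : ℕ → E}
    (hx : Tendsto x atTop (𝓝 a)) (hd : Tendsto (fun k => t k • (x k - a)) atTop (𝓝 d)) :
    Tendsto (fun k => t k * (φ (x k) - φ a)) atTop (𝓝 (fderiv ℝ φ a d)) := by
  have h1 := hφ.hasFDerivAt.isLittleO.comp_tendsto hx
  have h2 := (Asymptotics.isBigO_refl t atTop).smul_isLittleO h1
  have h3 := (h2.trans_isBigO (hd.isBigO_one ℝ)).tendsto_zero_of_tendsto tendsto_const_nhds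
  have h4 := h3.add (((fderiv ℝ φ a).continuous.tendsto d).comp hd)
  rw [zero_add] at h4
  refine h4.congr fun k => ?_
  simp only [Function.comp_apply, smul_eq_mul, map_smul]
  ring

/-- Under constant rank of the gradients of the equality constraints and of those active inequality
constraints whose derivatives vanish on the whole linearization cone, every direction of the
linearization cone is tangent. -/
theorem mem_tangentCone_of_rank_const {n : ℕ} {ι κ : Type*} [Fintype ι] [Finite κ]
    {g : ι → Vec n → ℝ} {q : κ → Vec n → ℝ} (hg : ∀ i, ContDiff ℝ 1 (g i))
    (hq : ∀ k, ContDiff ℝ 1 (q k)) {a : Vec n} (hga : ∀ i, g i a ≤ 0) (hqa : ∀ k, q k a = 0)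
    {L : Set (Vec n)}
    (hL : L = {d | (∀ i, g i a = 0 → fderiv ℝ (g i) a d ≤ 0) ∧ ∀ k, fderiv ℝ (q k) a d = 0})
    {I : Set ι} (hI : ∀ i, i ∈ I ↔ g i a = 0 ∧ ∀ d ∈ L, fderiv ℝ (g i) a d = 0)
    (hrank : ∀ᶠ x in 𝓝 a,
      Module.finrank ℝ (Submodule.span ℝ (range (Sum.elim (fun i : I => gradient (g i) x)
        fun k => gradient (q k) x))) =
      Module.finrank ℝ (Submodule.span ℝ (range (Sum.elim (fun i : I => gradient (g i) a)
        fun k => gradient (q k) a))))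
    {d : Vec n} (hd : d ∈ L) :
    d ∈ tangentCone {x | (∀ i, g i x ≤ 0) ∧ ∀ k, q k x = 0} a := by
  have hex : ∀ i, ∃ w ∈ L, g i a = 0 → i ∉ I → fderiv ℝ (g i) a w < 0 := by
    intro i
    by_cases hi : g i a = 0 ∧ i ∉ I
    · have h1 : ¬ ∀ d ∈ L, fderiv ℝ (g i) a d = 0 := fun h => hi.2 ((hI i).2 ⟨hi.1, h⟩)
      push Not at h1
      obtain ⟨w, hw, hne⟩ := h1
      have hw' := hw
      rw [hL] at hw'
      exact ⟨w, hw, fun _ _ => lt_of_le_of_ne (hw'.1 i hi.1) hne⟩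
    · refine ⟨0, by simp [hL], fun h1 h2 => absurd ⟨h1, h2⟩ hi⟩
  choose w hwL hw using hex
  have hwL' := hwL
  simp only [hL, mem_ofPred_eq] at hwL'
  have hd' := hd
  simp only [hL, mem_ofPred_eq] at hd'
  set w₀ := ∑ i, w i with hw₀
  have hw₀lt : ∀ i, g i a = 0 → i ∉ I → fderiv ℝ (g i) a w₀ < 0 := by
    intro i hi hiI
    rw [hw₀, map_sum]
    exact Finset.sum_neg' (fun j _ => (hwL' j).1 i hi) ⟨i, Finset.mem_univ i, hw i hi hiI⟩
  have hw₀q : ∀ k, fderiv ℝ (q k) a w₀ = 0 := fun k => by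
    rw [hw₀, map_sum]
    exact Finset.sum_eq_zero fun j _ => (hwL' j).2 k
  have hw₀I : ∀ i ∈ I, fderiv ℝ (g i) a w₀ = 0 := fun i hi => by
    rw [hw₀, map_sum]
    exact Finset.sum_eq_zero fun j _ => ((hI i).1 hi).2 _ (hwL j)
  refine mem_tangentCone_of_forall_approx fun ε hε => ?_
  obtain ⟨s, hs, hsε⟩ : ∃ s : ℝ, 0 < s ∧ ‖s • w₀‖ < ε / 2 := by
    have h1 : Tendsto (fun s : ℝ => ‖s • w₀‖) (𝓝[>] 0) (𝓝 0) := by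
      have : Tendsto (fun s : ℝ => ‖s • w₀‖) (𝓝 0) (𝓝 ‖(0 : ℝ) • w₀‖) :=
        Continuous.tendsto (by fun_prop) 0
      rw [zero_smul, norm_zero] at this
      exact this.mono_left nhdsWithin_le_nhds
    obtain ⟨s, h2, h3⟩ := ((h1.eventually (gt_mem_nhds (half_pos hε))).and
      self_mem_nhdsWithin).exists
    exact ⟨s, h3, h2⟩
  set v := d + s • w₀ with hv
  obtain ⟨ξ, hξ0, hξd, hξ⟩ := exists_curve_of_rank_const (a := a) (d := v)
    (φ := Sum.elim (fun i : I => g i) q)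
    (by rintro (i | k); exacts [hg i, hq k])
    (by
      have h1 : ∀ x, (fun i => gradient (Sum.elim (fun i : I => g i) q i) x) =
          Sum.elim (fun i : I => gradient (g i) x) fun k => gradient (q k) x := by
        intro x; ext1 i; cases i <;> rfl
      rw [h1 a]
      filter_upwards [hrank] with x hx
      rwa [h1 x])
    (by rintro (i | k); exacts [((hI i).1 i.2).1, hqa k])
    (by
      rintro (i | k)
      · simp [hv, ((hI i).1 i.2).2 d hd, hw₀I i i.2]
      · simp [hv, hd'.2 k, hw₀q k])
  have hξc : Tendsto ξ (𝓝 0) (𝓝 a) := by simpa [hξ0] using hξd.continuousAt.tendsto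
  have hgneg : ∀ i, ∀ᶠ t in 𝓝[>] (0 : ℝ), g i (ξ t) ≤ 0 := by
    intro i
    by_cases hi : g i a = 0
    · by_cases hiI : i ∈ I
      · filter_upwards [nhdsWithin_le_nhds hξ] with t ht using (ht (Sum.inl ⟨i, hiI⟩)).le
      · have hneg : fderiv ℝ (g i) a v < 0 := by
          rw [hv, map_add, map_smul, smul_eq_mul]
          have := hd'.1 i hi
          have := mul_neg_of_pos_of_neg hs (hw₀lt i hi hiI)
          linarith
        have h1 : HasFDerivAt (g i) (fderiv ℝ (g i) a) (ξ 0) := by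
          rw [hξ0]; exact ((hg i).differentiable one_ne_zero a).hasFDerivAt
        have h2 := (h1.comp_hasDerivAt 0 hξd).tendsto_slope_zero_right
        filter_upwards [h2.eventually (gt_mem_nhds hneg), self_mem_nhdsWithin] with t ht ht0
        simp only [zero_add, Function.comp_apply, hξ0, hi, sub_zero, smul_eq_mul] at ht
        by_contra! hcon
        exact absurd ht (not_lt.2 (mul_nonneg (inv_nonneg.2 (le_of_lt ht0)) hcon.le))
    · have h1 : Tendsto (fun t => g i (ξ t)) (𝓝 0) (𝓝 (g i a)) :=
        ((hg i).continuous.tendsto a).comp hξc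
      filter_upwards [nhdsWithin_le_nhds (h1.eventually (gt_mem_nhds (lt_of_le_of_ne (hga i) hi)))]
        with t ht using ht.le
  have hslope := hξd.tendsto_slope_zero_right
  have hall := ((eventually_all.2 hgneg).and ((hξ.filter_mono nhdsWithin_le_nhds).and
    (((hξc.eventually (Metric.ball_mem_nhds a hε)).filter_mono nhdsWithin_le_nhds).and
      ((hslope.eventually (Metric.ball_mem_nhds v (half_pos hε))).and self_mem_nhdsWithin)))).exists
  obtain ⟨t, ht1, ht2, ht3, ht4, ht5⟩ := hall
  refine ⟨t⁻¹, inv_nonneg.2 (le_of_lt ht5), ξ t, ⟨ht1, fun k => ht2 (Sum.inr k)⟩, ?_, ?_⟩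
  · rwa [dist_eq_norm] at ht3
  · rw [dist_eq_norm, zero_add, hξ0] at ht4
    calc ‖t⁻¹ • (ξ t - a) - d‖ = ‖(t⁻¹ • (ξ t - a) - v) + s • w₀‖ := by rw [hv]; congr 1; abel
      _ ≤ ‖t⁻¹ • (ξ t - a) - v‖ + ‖s • w₀‖ := norm_add_le _ _
      _ < ε := by linarith

theorem tangentCone_feas_subset_LCone {n m p l : ℕ} {g : Fin m → Vec n → ℝ}
    {h : Fin p → Vec n → ℝ} {G H : Fin l → Vec n → ℝ} {xb : Vec n}
    (hg : ∀ i, DifferentiableAt ℝ (g i) xb) (hh : ∀ j, DifferentiableAt ℝ (h j) xb)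
    (hG : ∀ k, DifferentiableAt ℝ (G k) xb) (hH : ∀ k, DifferentiableAt ℝ (H k) xb)
    (hxb : xb ∈ Feas g h G H) :
    tangentCone (Feas g h G H) xb ⊆ LCone g h G H xb := by
  rintro d ⟨t, x, ht, hx, hxt, hd⟩
  refine ⟨fun i hi => ?_, fun j => ?_, fun k hk => ?_, fun k hk => ?_, fun k hk => ?_⟩
  · have h1 := tendsto_mul_sub_of_tendsto_smul_sub (hg i) hxt hd
    refine le_of_tendsto' h1 fun r => ?_
    have h2 : g i xb = 0 := hi
    rw [h2, sub_zero]
    exact mul_nonpos_of_nonneg_of_nonpos (ht r) ((hx r).1 i)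
  · have h1 := tendsto_mul_sub_of_tendsto_smul_sub (hh j) hxt hd
    refine tendsto_nhds_unique h1 (tendsto_const_nhds.congr fun r => ?_)
    rw [(hx r).2.1 j, hxb.2.1 j, sub_zero, mul_zero]
  · have h1 := tendsto_mul_sub_of_tendsto_smul_sub (hG k) hxt hd
    have h2 := ((hH k).continuousAt.tendsto.comp hxt).eventually (isOpen_ne.mem_nhds hk.2)
    refine tendsto_nhds_unique h1 (tendsto_const_nhds.congr' ?_)
    filter_upwards [h2] with r hr
    rw [(mul_eq_zero.1 ((hx r).2.2 k)).resolve_right hr, hk.1, sub_zero, mul_zero]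
  · have h1 := tendsto_mul_sub_of_tendsto_smul_sub (hH k) hxt hd
    have h2 := ((hG k).continuousAt.tendsto.comp hxt).eventually (isOpen_ne.mem_nhds hk.1)
    refine tendsto_nhds_unique h1 (tendsto_const_nhds.congr' ?_)
    filter_upwards [h2] with r hr
    rw [(mul_eq_zero.1 ((hx r).2.2 k)).resolve_left hr, hk.2, sub_zero, mul_zero]
  · have h1 := (tendsto_mul_sub_of_tendsto_smul_sub (hG k) hxt hd).mul
      (tendsto_mul_sub_of_tendsto_smul_sub (hH k) hxt hd)
    refine tendsto_nhds_unique h1 (tendsto_const_nhds.congr fun r => ?_)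
    rw [hk.1, hk.2, sub_zero, sub_zero, mul_mul_mul_comm, (hx r).2.2 k, mul_zero]

/-- `IgMinus` consists of the active inequality constraints whose derivatives vanish on the whole
branch linearization cone. -/
theorem mem_IgMinus_iff {n m p l : ℕ} {g : Fin m → Vec n → ℝ}
    {h : Fin p → Vec n → ℝ} {G H : Fin l → Vec n → ℝ} {xb : Vec n} {β1 β2 : Set (Fin l)}
    {i : Fin m} :
    i ∈ IgMinus g h G H xb β1 β2 ↔
      i ∈ Ig g xb ∧ ∀ d ∈ BranchLCone g h G H xb β1 β2, fderiv ℝ (g i) xb d = 0 := by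
  classical
  constructor
  · rintro ⟨hi, lam, ρ, μ, ν, hlam, hlam0, hμ, hν, heq⟩
    refine ⟨hi, fun d hd => le_antisymm (hd.1 i hi) ?_⟩
    have h1 := congrArg (fun z => inner ℝ z d) heq
    simp only [inner_neg_left, inner_add_left, sum_inner, inner_smul_left, inner_gradient,
      conj_trivial] at h1
    have h2 : ∑ i', lam i' * fderiv ℝ (g i') xb d ≤ 0 := Finset.sum_nonpos fun i' _ => by
      by_cases hi' : i' ∈ Ig g xb \ {i}
      · exact mul_nonpos_of_nonneg_of_nonpos (hlam i') (hd.1 i' hi'.1)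
      · rw [hlam0 i' hi', zero_mul]
    have h3 : ∑ j, ρ j * fderiv ℝ (h j) xb d = 0 := Finset.sum_eq_zero fun j _ => by
      rw [hd.2.1 j, mul_zero]
    have h4 : ∑ k, μ k * fderiv ℝ (G k) xb d = 0 := Finset.sum_eq_zero fun k _ => by
      by_cases hk : k ∈ IG G H xb ∪ β1
      · rw [hd.2.2.1 k hk, mul_zero]
      · rw [hμ k hk, zero_mul]
    have h5 : ∑ k, ν k * fderiv ℝ (H k) xb d = 0 := Finset.sum_eq_zero fun k _ => by
      by_cases hk : k ∈ IH G H xb ∪ β2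
      · rw [hd.2.2.2 k hk, mul_zero]
      · rw [hν k hk, zero_mul]
    linarith
  · rintro ⟨hi, hvan⟩
    obtain ⟨c, σ, hc, heq⟩ := farkas (V := Vec n)
      (fun k : Fin p ⊕ Fin l ⊕ Fin l => Sum.elim (fun j => (fderiv ℝ (h j) xb : Vec n →ₗ[ℝ] ℝ))
        (Sum.elim (fun k => if k ∈ IG G H xb ∪ β1 then (fderiv ℝ (G k) xb : Vec n →ₗ[ℝ] ℝ) else 0)
          (fun k => if k ∈ IH G H xb ∪ β2 then (fderiv ℝ (H k) xb : Vec n →ₗ[ℝ] ℝ) else 0)) k)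
      {i' | i' ∈ Ig g xb \ {i}} (fun i' => -(fderiv ℝ (g i') xb : Vec n →ₗ[ℝ] ℝ))
      (fderiv ℝ (g i) xb : Vec n →ₗ[ℝ] ℝ) (by
        intro d hd hd0
        by_contra! hneg
        refine hneg.ne (hvan d ⟨fun i' hi' => ?_, fun j => ?_, fun k hk => ?_, fun k hk => ?_⟩)
        · by_cases hii : i' = i
          · subst hii; exact hneg.le
          · simpa using hd i' (by simp [hi', hii])
        · simpa using hd0 (Sum.inl j)
        · have := hd0 (Sum.inr (Sum.inl k))
          rw [Sum.elim_inr, Sum.elim_inl, if_pos hk] at this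
          exact this
        · have := hd0 (Sum.inr (Sum.inr k))
          rw [Sum.elim_inr, Sum.elim_inr, if_pos hk] at this
          exact this)
    refine ⟨hi, fun i' => if i' ∈ Ig g xb \ {i} then c i' else 0, fun j => -σ (Sum.inl j),
      fun k => if k ∈ IG G H xb ∪ β1 then -σ (Sum.inr (Sum.inl k)) else 0,
      fun k => if k ∈ IH G H xb ∪ β2 then -σ (Sum.inr (Sum.inr k)) else 0,
      fun i' => ?_, fun i' hi' => if_neg hi', fun k hk => if_neg hk, fun k hk => if_neg hk, ?_⟩
    · dsimp only
      split_ifs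
      exacts [hc i', le_rfl]
    · refine ext_inner_right ℝ fun d => ?_
      have h1 := LinearMap.congr_fun heq d
      simp only [Fintype.sum_sum_type, Sum.elim_inl, Sum.elim_inr, LinearMap.add_apply,
        LinearMap.sum_apply, LinearMap.smul_apply, smul_eq_mul,
        Finset.sum_filter, ContinuousLinearMap.coe_coe] at h1
      simp only [inner_neg_left, inner_add_left, sum_inner, inner_smul_left, inner_gradient,
        conj_trivial]
      rw [h1, neg_add, neg_add, neg_add]
      simp only [← Finset.sum_neg_distrib, ← add_assoc]
      congr 1
      · congr 1
        · congr 1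
          · refine Finset.sum_congr rfl fun i' _ => ?_
            split_ifs <;> simp
          · exact Finset.sum_congr rfl fun j _ => by ring
        · refine Finset.sum_congr rfl fun k _ => ?_
          split_ifs <;> simp
      · refine Finset.sum_congr rfl fun k _ => ?_
        split_ifs <;> simp

theorem exists_partition_mem_BranchLCone {n m p l : ℕ} {g : Fin m → Vec n → ℝ}
    {h : Fin p → Vec n → ℝ} {G H : Fin l → Vec n → ℝ} {xb d : Vec n}
    (hd : d ∈ LCone g h G H xb) :
    ∃ β1 β2, Partition G H xb β1 β2 ∧ d ∈ BranchLCone g h G H xb β1 β2 := by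
  refine ⟨{k | k ∈ IGH G H xb ∧ fderiv ℝ (G k) xb d = 0},
    {k | k ∈ IGH G H xb ∧ fderiv ℝ (G k) xb d ≠ 0}, ⟨?_, ?_⟩, hd.1, hd.2.1, ?_, ?_⟩
  · ext k
    simp only [mem_inter_iff, mem_ofPred_eq, mem_empty_iff_false, iff_false]
    tauto
  · ext k
    simp only [mem_union, mem_ofPred_eq]
    tauto
  · rintro k (hk | hk)
    exacts [hd.2.2.1 k hk, hk.2]
  · rintro k (hk | hk)
    exacts [hd.2.2.2.1 k hk, (mul_eq_zero.1 (hd.2.2.2.2 k hk.1)).resolve_left hk.2]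

theorem BranchFeas_subset_Feas {n m p l : ℕ} {g : Fin m → Vec n → ℝ}
    {h : Fin p → Vec n → ℝ} {G H : Fin l → Vec n → ℝ} {xb : Vec n} {β1 β2 : Set (Fin l)}
    (hxb : xb ∈ Feas g h G H) (hβ : Partition G H xb β1 β2) :
    BranchFeas g h G H xb β1 β2 ⊆ Feas g h G H := by
  rintro x ⟨hxg, hxh, hxG, hxH⟩
  refine ⟨hxg, hxh, fun k => ?_⟩
  by_cases h1 : G k xb = 0
  · by_cases h2 : H k xb = 0
    · have hk : k ∈ β1 ∪ β2 := by rw [hβ.2]; exact ⟨h1, h2⟩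
      rcases hk with hk | hk
      · rw [hxG k (Or.inr hk), zero_mul]
      · rw [hxH k (Or.inr hk), mul_zero]
    · rw [hxG k (Or.inl ⟨h1, h2⟩), zero_mul]
  · rw [hxH k (Or.inl ⟨h1, (mul_eq_zero.1 (hxb.2.2 k)).resolve_left h1⟩), mul_zero]

theorem tangentCone_mono {n : ℕ} {Ω Ω' : Set (Vec n)} (hΩ : Ω ⊆ Ω') (a : Vec n) :
    tangentCone Ω a ⊆ tangentCone Ω' a := by
  rintro d ⟨t, x, ht, hx, h⟩
  exact ⟨t, x, ht, fun k => hΩ (hx k), h⟩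

theorem BranchLCone_subset_tangentCone {n m p l : ℕ} {g : Fin m → Vec n → ℝ}
    {h : Fin p → Vec n → ℝ} {G H : Fin l → Vec n → ℝ}
    (hg : ∀ i, ContDiff ℝ 1 (g i)) (hh : ∀ j, ContDiff ℝ 1 (h j))
    (hG : ∀ k, ContDiff ℝ 1 (G k)) (hH : ∀ k, ContDiff ℝ 1 (H k))
    {xb : Vec n} (hxb : xb ∈ Feas g h G H) {β1 β2 : Set (Fin l)} (hβ : Partition G H xb β1 β2)
    {ε : ℝ} (hε : 0 < ε)
    (hrank : ∀ x : Vec n, ‖x - xb‖ < ε →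
      gradRank g h G H (IgMinus g h G H xb β1 β2) (IG G H xb ∪ β1) (IH G H xb ∪ β2) x =
      gradRank g h G H (IgMinus g h G H xb β1 β2) (IG G H xb ∪ β1) (IH G H xb ∪ β2) xb) :
    BranchLCone g h G H xb β1 β2 ⊆ tangentCone (BranchFeas g h G H xb β1 β2) xb := by
  intro d hd
  let q : Fin p ⊕ ↥(IG G H xb ∪ β1) ⊕ ↥(IH G H xb ∪ β2) → Vec n → ℝ :=
    Sum.elim h (Sum.elim (fun k => G k) fun k => H k)
  have hspan : ∀ x, gradRank g h G H (IgMinus g h G H xb β1 β2) (IG G H xb ∪ β1)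
      (IH G H xb ∪ β2) x = Module.finrank ℝ (Submodule.span ℝ (range (Sum.elim
        (fun i : ↥(IgMinus g h G H xb β1 β2) => gradient (g i) x)
        fun k => gradient (q k) x))) := by
    intro x
    have h1 : (fun k => gradient (q k) x) = Sum.elim (fun j => gradient (h j) x)
        (Sum.elim (fun k : ↥(IG G H xb ∪ β1) => gradient (G k) x)
          fun k : ↥(IH G H xb ∪ β2) => gradient (H k) x) := by
      ext1 k; rcases k with j | k | k <;> rfl
    rw [gradRank, h1, Set.Sum.elim_range, Set.Sum.elim_range, Set.Sum.elim_range,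
      image_eq_range, image_eq_range, image_eq_range, union_assoc, union_assoc]
  have hmem := mem_tangentCone_of_rank_const hg (q := q)
    (by rintro (j | k | k); exacts [hh j, hG k, hH k]) hxb.1
    (by
      rintro (j | ⟨k, hk⟩ | ⟨k, hk⟩)
      · exact hxb.2.1 j
      · rcases hk with hk | hk
        · exact hk.1
        · exact (hβ.2.subset (Or.inl hk)).1
      · rcases hk with hk | hk
        · exact hk.2
        · exact (hβ.2.subset (Or.inr hk)).2)
    (L := BranchLCone g h G H xb β1 β2)
    (by
      ext d
      simp [BranchLCone, q, Ig, Sum.forall])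
    (I := IgMinus g h G H xb β1 β2) (fun i => mem_IgMinus_iff)
    (by
      filter_upwards [Metric.ball_mem_nhds xb hε] with x hx
      rw [Metric.mem_ball, dist_eq_norm] at hx
      rw [← hspan, ← hspan]
      exact hrank x hx) hd
  refine tangentCone_mono ?_ xb hmem
  rintro x ⟨hxg, hxq⟩
  exact ⟨hxg, fun j => hxq (Sum.inl j), fun k hk => hxq (Sum.inr (Sum.inl ⟨k, hk⟩)),
    fun k hk => hxq (Sum.inr (Sum.inr ⟨k, hk⟩))⟩

theorem pcrsc_implies_acq {n m p l : ℕ} (f : Vec n → ℝ) (g : Fin m → Vec n → ℝ)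
    (h : Fin p → Vec n → ℝ) (G H : Fin l → Vec n → ℝ)
    (hf : ContDiff ℝ 2 f) (hg : ∀ i, ContDiff ℝ 2 (g i)) (hh : ∀ j, ContDiff ℝ 2 (h j))
    (hG : ∀ k, ContDiff ℝ 2 (G k)) (hH : ∀ k, ContDiff ℝ 2 (H k))
    (xb : Vec n) (hxb : xb ∈ Feas g h G H)
    (hcq : PCRSC g h G H xb) :
    tangentCone (Feas g h G H) xb = LCone g h G H xb := by
  refine Subset.antisymm (tangentCone_feas_subset_LCone
    (fun i => (hg i).differentiable two_ne_zero xb) (fun j => (hh j).differentiable two_ne_zero xb)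
    (fun k => (hG k).differentiable two_ne_zero xb) (fun k => (hH k).differentiable two_ne_zero xb)
    hxb) fun d hd => ?_
  obtain ⟨β1, β2, hβ, hdβ⟩ := exists_partition_mem_BranchLCone hd
  obtain ⟨ε, hε, hrank⟩ := hcq β1 β2 hβ
  exact tangentCone_mono (BranchFeas_subset_Feas hxb hβ) xb
    (BranchLCone_subset_tangentCone (fun i => (hg i).of_le one_le_two)
      (fun j => (hh j).of_le one_le_two) (fun k => (hG k).of_le one_le_two)
      (fun k => (hH k).of_le one_le_two) hxb hβ hε hrank hdβ)

end MPSC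
end
end

section
/- Let x̄ ∈ F be a feasible point of (MPSC) and assume that MPSC-PWCR and MPSC-PSOQN hold at x̄. Then the local error bound of (MPSC) holds at x̄, i.e., there exist ε > 0 and α > 0 such that dist(x, F) ≤ α·(Σ_{i=1}^m [max{g_i(x), 0}]² + Σ_{j=1}^p [h_j(x)]² + Σ_{k=1}^l min{[G_k(x)]², [H_k(x)]²})^{1/2} for all x with ‖x − x̄‖ < ε. -/
open Set Filter Topology Metric

noncomputable section

namespace MPSC

variable {n m p l : ℕ}

theorem apply_sum_deriv_eq_zero_of_finrank_const {ι F : Type*} [Fintype ι]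
    [NormedAddCommGroup F] [NormedSpace ℝ F] [FiniteDimensional ℝ F] {v : ι → ℝ → F} {v' : ι → F}
    (hv : ∀ i, HasDerivAt (v i) (v' i) 0)
    (hrank : ∀ᶠ t in 𝓝 (0 : ℝ), Module.finrank ℝ (Submodule.span ℝ (range fun i => v i t)) =
      Module.finrank ℝ (Submodule.span ℝ (range fun i => v i 0)))
    {M : ι → ℝ} (hM : ∑ i, M i • v i 0 = 0) {φ : F →L[ℝ] ℝ} (hφ : ∀ i, φ (v i 0) = 0) :
    ∑ i, M i * φ (v' i) = 0 := by
  obtain ⟨κ, a, ha, hspan, hli⟩ := exists_linearIndependent' ℝ (fun i => v i 0)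
  have : Finite κ := Finite.of_injective a ha
  have := Fintype.ofFinite κ
  obtain ⟨K, hK, hanti⟩ := LinearMap.exists_antilipschitzWith
    (Fintype.linearCombination ℝ ((fun i => v i 0) ∘ a))
    (LinearMap.ker_eq_bot.2 hli.fintypeLinearCombination_injective)
  have hbound0 (b : κ → ℝ) : ‖b‖ ≤ K * ‖∑ k, b k • v (a k) 0‖ := by
    simpa [Fintype.linearCombination_apply] using hanti.le_mul_norm_sub b 0
  have hclose : ∀ᶠ t in 𝓝 (0 : ℝ), K * ∑ k, ‖v (a k) t - v (a k) 0‖ < 1 / 2 := by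
    have : Tendsto (fun t => K * ∑ k, ‖v (a k) t - v (a k) 0‖) (𝓝 0)
        (𝓝 (K * ∑ k, ‖v (a k) 0 - v (a k) 0‖)) :=
      (tendsto_finsetSum _ fun k _ =>
        ((hv (a k)).continuousAt.tendsto.sub tendsto_const_nhds).norm).const_mul _
    exact this.eventually_lt_const (by simp)
  have hbound : ∀ᶠ t in 𝓝 (0 : ℝ), ∀ b : κ → ℝ, ‖b‖ ≤ 2 * K * ‖∑ k, b k • v (a k) t‖ := by
    filter_upwards [hclose] with t ht b
    have h1 : ∑ k, b k • v (a k) 0 =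
        ∑ k, b k • v (a k) t - ∑ k, b k • (v (a k) t - v (a k) 0) := by
      simp [smul_sub]
    have h2 : ‖∑ k, b k • (v (a k) t - v (a k) 0)‖ ≤ ‖b‖ * ∑ k, ‖v (a k) t - v (a k) 0‖ := by
      rw [Finset.mul_sum]
      refine norm_sum_le_of_le _ fun k _ => ?_
      rw [norm_smul]
      gcongr
      exact norm_le_pi_norm b k
    have h3 := hbound0 b
    rw [h1] at h3
    have h4 := norm_sub_le (∑ k, b k • v (a k) t) (∑ k, b k • (v (a k) t - v (a k) 0))
    have hK' : (0 : ℝ) ≤ K := K.2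
    have h5 := mul_le_mul_of_nonneg_left (h4.trans (add_le_add_right h2 _)) hK'
    nlinarith [norm_nonneg b]
  set w : ℝ → F := fun t => ∑ i, M i • v i t with hw
  have hwderiv : HasDerivAt w (∑ i, M i • v' i) 0 :=
    HasDerivAt.fun_sum fun i _ => (hv i).const_smul (M i)
  have hest : ∀ᶠ t in 𝓝 (0 : ℝ), ‖φ (w t)‖ ≤ ‖(2 * K * ∑ k, ‖φ (v (a k) t)‖) * ‖w t‖‖ := by
    filter_upwards [hbound, hrank] with t hb hr
    have hli' : LinearIndependent ℝ fun k => v (a k) t := by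
      rw [Fintype.linearIndependent_iff]
      intro b hb0
      have := hb b
      rw [hb0, norm_zero, mul_zero, norm_le_zero_iff] at this
      simp [this]
    have hsub : Submodule.span ℝ (range fun k => v (a k) t) ≤
        Submodule.span ℝ (range fun i => v i t) :=
      Submodule.span_mono (by rintro _ ⟨k, rfl⟩; exact ⟨a k, rfl⟩)
    have heq := Submodule.eq_of_le_of_finrank_eq hsub (by
      rw [hr, ← hspan, finrank_span_eq_card hli', finrank_span_eq_card hli])
    have hmem : w t ∈ Submodule.span ℝ (range fun k => v (a k) t) := by
      rw [heq]
      exact Submodule.sum_mem _ fun i _ =>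
        Submodule.smul_mem _ _ (Submodule.subset_span ⟨i, rfl⟩)
    obtain ⟨b, hbw⟩ := (Submodule.mem_span_range_iff_exists_fun ℝ).1 hmem
    have hbn := hb b
    rw [hbw] at hbn
    have hcoef : (0 : ℝ) ≤ 2 * K * ∑ k, ‖φ (v (a k) t)‖ := by positivity
    rw [Real.norm_of_nonneg (mul_nonneg hcoef (norm_nonneg _))]
    calc ‖φ (w t)‖ = ‖∑ k, φ (b k • v (a k) t)‖ := by rw [← hbw, map_sum]
      _ ≤ ∑ k, ‖b‖ * ‖φ (v (a k) t)‖ := by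
          refine norm_sum_le_of_le _ fun k _ => ?_
          rw [map_smul, norm_smul]
          gcongr
          exact norm_le_pi_norm b k
      _ = ‖b‖ * ∑ k, ‖φ (v (a k) t)‖ := by rw [Finset.mul_sum]
      _ ≤ (2 * K * ‖w t‖) * ∑ k, ‖φ (v (a k) t)‖ := by gcongr
      _ = _ := by ring
  have hsmall : Tendsto (fun t => 2 * K * ∑ k, ‖φ (v (a k) t)‖) (𝓝 0) (𝓝 0) := by
    have : Tendsto (fun t => 2 * K * ∑ k, ‖φ (v (a k) t)‖) (𝓝 0)
        (𝓝 (2 * K * ∑ k, ‖φ (v (a k) 0)‖)) :=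
      (tendsto_finsetSum _ fun k _ =>
        (φ.continuous.tendsto _ |>.comp (hv (a k)).continuousAt.tendsto).norm).const_mul _
    simpa [hφ] using this
  have hwO : w =O[𝓝 0] fun t => t := by
    simpa [hw, hM] using hwderiv.isBigO_sub
  have hφo : (fun t => φ (w t)) =o[𝓝 0] fun t : ℝ => t := by
    have h1 := ((Asymptotics.isLittleO_one_iff ℝ).2 hsmall).mul_isBigO hwO.norm_left
    simpa using (Asymptotics.IsBigO.of_bound' hest).trans_isLittleO h1
  have hzero : HasDerivAt (fun t => φ (w t)) 0 0 := by
    rw [hasDerivAt_iff_isLittleO]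
    simpa [hw, hM] using hφo
  have := (φ.hasFDerivAt.comp_hasDerivAt 0 hwderiv).unique hzero
  simpa using this

theorem hasDerivAt_max_zero_sq (u : ℝ) :
    HasDerivAt (fun x : ℝ => max x 0 ^ 2) (2 * max u 0) u := by
  rw [hasDerivAt_iff_isLittleO]
  have h : (fun x : ℝ => (x - u) ^ 2) =o[𝓝 u] fun x => x - u := by
    have : Tendsto (fun x : ℝ => x - u) (𝓝 u) (𝓝 0) := by
      simpa using (continuous_id.sub continuous_const).tendsto (f := fun x : ℝ => x - u) u
    simpa [pow_two] using
      ((Asymptotics.isLittleO_one_iff ℝ).2 this).mul_isBigO (Asymptotics.isBigO_refl _ _)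
  refine Asymptotics.IsBigO.trans_isLittleO (.of_bound' (.of_forall fun x => ?_)) h
  rw [Real.norm_eq_abs, Real.norm_of_nonneg (sq_nonneg _), smul_eq_mul, abs_le]
  rcases max_cases x 0 with ⟨h1, h2⟩ | ⟨h1, h2⟩ <;> rcases max_cases u 0 with ⟨h3, h4⟩ | ⟨h3, h4⟩ <;>
    rw [h1, h3] <;> constructor <;> nlinarith

/-- Violation at value `u` of the constraint `u ≤ 0` (if `P`) or `u = 0` (otherwise). -/
noncomputable def viol (P : Prop) [Decidable P] (u : ℝ) : ℝ := if P then max u 0 else u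

section Viol

variable {P : Prop} [Decidable P]

theorem hasDerivAt_viol_sq (u : ℝ) :
    HasDerivAt (fun x => viol P x ^ 2) (2 * viol P u) u := by
  by_cases h : P
  · simpa [viol, h] using hasDerivAt_max_zero_sq u
  · simpa [viol, h] using hasDerivAt_pow 2 u

theorem continuous_viol : Continuous (viol P) := by
  unfold viol
  split_ifs <;> fun_prop

theorem viol_nonneg (h : P) (u : ℝ) : 0 ≤ viol P u := by simp [viol, h]

theorem viol_mul_pos {u : ℝ} (h : viol P u ≠ 0) : 0 < viol P u * u := by
  by_cases hP : P
  · simp only [viol, hP, if_true] at *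
    rcases max_cases u 0 with ⟨h1, h2⟩ | ⟨h1, h2⟩
    · rw [h1] at h ⊢
      exact mul_self_pos.2 h
    · exact absurd h1 h
  · simp only [viol, hP, if_false] at *
    exact mul_self_pos.2 h

end Viol

theorem norm_le_of_forall_sub_le {E : Type*} [NormedAddCommGroup E] [NormedSpace ℝ E]
    {R : E → ℝ} {L : E →L[ℝ] ℝ} {z : E} {σ : ℝ} (hσ : 0 ≤ σ) (hL : HasFDerivAt R L z)
    (h : ∀ y, R z - σ * ‖y - z‖ ≤ R y) : ‖L‖ ≤ σ := by
  have key (v : E) : -(σ * ‖v‖) ≤ L v := by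
    have h1 := hL.hasLineDerivAt v
    have h2 := hasDerivAt_iff_tendsto_slope_zero.1 h1
    have h3 := h2.mono_left (nhdsWithin_mono 0 (fun x (hx : x ∈ Ioi (0 : ℝ)) => ne_of_gt hx))
    refine ge_of_tendsto h3 ?_
    filter_upwards [self_mem_nhdsWithin] with t ht
    have ht' : (0 : ℝ) < t := ht
    have h4 := h (z + t • v)
    rw [add_sub_cancel_left, norm_smul, Real.norm_of_nonneg ht'.le] at h4
    simp only [zero_add, zero_smul, add_zero, smul_eq_mul]
    rw [inv_mul_eq_div, le_div_iff₀ ht']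
    linarith
  refine L.opNorm_le_bound hσ fun v => abs_le.2 ⟨key v, ?_⟩
  have := key (-v)
  rw [norm_neg, map_neg] at this
  linarith

/-- Euclidean norm of the vector of constraint violations. -/
noncomputable def violNorm {ι E : Type*} [Fintype ι] (P : ι → Prop) [DecidablePred P]
    (c : ι → E → ℝ) (x : E) : ℝ :=
  √(∑ i, viol (P i) (c i x) ^ 2)

section ViolNorm

variable {ι E : Type*} [Fintype ι] {P : ι → Prop} [DecidablePred P] {c : ι → E → ℝ}

theorem violNorm_nonneg (x : E) : 0 ≤ violNorm P c x := Real.sqrt_nonneg _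

theorem violNorm_eq_zero_iff {x : E} :
    violNorm P c x = 0 ↔ ∀ i, viol (P i) (c i x) = 0 := by
  rw [violNorm, Real.sqrt_eq_zero (by positivity),
    Finset.sum_eq_zero_iff_of_nonneg fun i _ => sq_nonneg _]
  simp

theorem continuous_violNorm [TopologicalSpace E] (hc : ∀ i, Continuous (c i)) :
    Continuous (violNorm P c) :=
  (continuous_finsetSum _ fun i _ => (continuous_viol.comp (hc i)).pow 2).sqrt

variable [NormedAddCommGroup E] [NormedSpace ℝ E]

theorem hasFDerivAt_violNorm {z : E} (hc : ∀ i, DifferentiableAt ℝ (c i) z)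
    (hz : violNorm P c z ≠ 0) :
    HasFDerivAt (violNorm P c)
      (∑ i, (viol (P i) (c i z) / violNorm P c z) • fderiv ℝ (c i) z) z := by
  have h1 : HasFDerivAt (fun x => ∑ i, viol (P i) (c i x) ^ 2)
      (∑ i, (2 * viol (P i) (c i z)) • fderiv ℝ (c i) z) z :=
    HasFDerivAt.fun_sum fun i _ => (hasDerivAt_viol_sq _).comp_hasFDerivAt z (hc i).hasFDerivAt
  have h2 := h1.sqrt (fun h => hz (by rw [violNorm, h, Real.sqrt_zero]))
  refine h2.congr_fderiv ?_
  rw [Finset.smul_sum]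
  refine Finset.sum_congr rfl fun i _ => ?_
  rw [smul_smul]
  congr 1
  change 1 / (2 * violNorm P c z) * _ = _
  field_simp

/-- Minimising `violNorm + σ * dist x` gives an infeasible point where the derivative of
`violNorm` is small. -/
theorem exists_almost_critical [FiniteDimensional ℝ E] (hc : ∀ i, Differentiable ℝ (c i))
    {xb x : E} (hxb : violNorm P c xb = 0) {σ : ℝ} (hσ : 0 < σ)
    (hx : violNorm P c x < σ * infDist x {y | violNorm P c y = 0}) :
    ∃ z, ‖z - x‖ ≤ ‖x - xb‖ ∧ violNorm P c z ≠ 0 ∧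
      ‖∑ i, (viol (P i) (c i z) / violNorm P c z) • fderiv ℝ (c i) z‖ ≤ σ := by
  have hcont : Continuous fun z => violNorm P c z + σ * ‖z - x‖ :=
    (continuous_violNorm fun i => (hc i).continuous).add (by fun_prop)
  have : ProperSpace E := FiniteDimensional.proper ℝ E
  obtain ⟨z, hz⟩ := hcont.exists_forall_le' x (by
    have := (isCompact_closedBall x (violNorm P c x / σ)).compl_mem_cocompact
    filter_upwards [this] with y hy
    rw [mem_compl_iff, mem_closedBall, dist_eq_norm, not_le, div_lt_iff₀ hσ] at hy
    have := violNorm_nonneg (P := P) (c := c) y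
    simp only [sub_self, norm_zero, mul_zero, add_zero]
    linarith)
  have h1 := hz x
  simp only [sub_self, norm_zero, mul_zero, add_zero] at h1
  have h2 : ‖z - x‖ < infDist x {y | violNorm P c y = 0} := by
    have := violNorm_nonneg (P := P) (c := c) z
    exact lt_of_mul_lt_mul_left (by linarith) hσ.le
  have h3 : violNorm P c z ≠ 0 := fun h => by
    have := infDist_le_dist_of_mem (x := x) (show z ∈ {y | violNorm P c y = 0} from h)
    rw [dist_comm, dist_eq_norm] at this
    linarith
  refine ⟨z, ?_, h3, norm_le_of_forall_sub_le hσ.le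
    (hasFDerivAt_violNorm (fun i => hc i z) h3) fun y => ?_⟩
  · have := infDist_le_dist_of_mem (x := x) (show xb ∈ {y | violNorm P c y = 0} from hxb)
    rw [dist_eq_norm] at this
    linarith
  · have h4 := hz y
    have h5 : ‖y - x‖ ≤ ‖y - z‖ + ‖z - x‖ := by simpa using norm_add_le (y - z) (z - x)
    nlinarith

/-- Quasi-normality implies a local error bound. -/
theorem exists_error_bound_of_quasinormal [FiniteDimensional ℝ E] (hc : ∀ i, ContDiff ℝ 1 (c i))
    {xb : E} (hxb : violNorm P c xb = 0)
    (hqn : ∀ M : ι → ℝ, (∀ i, P i → 0 ≤ M i) → ∑ i, M i • fderiv ℝ (c i) xb = 0 →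
      (∃ xs : ℕ → E, Tendsto xs atTop (𝓝 xb) ∧ ∀ s i, M i ≠ 0 → 0 < M i * c i (xs s)) → M = 0) :
    ∃ K > 0, ∀ᶠ x in 𝓝 xb, infDist x {y | violNorm P c y = 0} ≤ K * violNorm P c x := by
  by_contra! hcon
  have hex (s : ℕ) : ∃ z, ‖z - xb‖ ≤ 2 * (1 / ((s : ℝ) + 1)) ∧ violNorm P c z ≠ 0 ∧
      ‖∑ i, (viol (P i) (c i z) / violNorm P c z) • fderiv ℝ (c i) z‖ ≤ 1 / ((s : ℝ) + 1) := by
    have hs : (0 : ℝ) < s + 1 := by positivity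
    obtain ⟨x, hx, hxs⟩ := ((hcon (s + 1) hs).and_eventually
      (ball_mem_nhds xb (show 0 < 1 / ((s : ℝ) + 1) by positivity))).exists
    obtain ⟨z, hz1, hz2, hz3⟩ := exists_almost_critical
      (fun i => (hc i).differentiable one_ne_zero) hxb
      (show 0 < 1 / ((s : ℝ) + 1) by positivity) (x := x) (by
        rwa [one_div_mul_eq_div, lt_div_iff₀' hs])
    refine ⟨z, ?_, hz2, hz3⟩
    rw [dist_eq_norm] at hxs
    have : ‖z - xb‖ ≤ ‖z - x‖ + ‖x - xb‖ := by simpa using norm_add_le (z - x) (x - xb)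
    linarith
  choose z hz1 hz2 hz3 using hex
  set M : ℕ → ι → ℝ := fun s i => viol (P i) (c i (z s)) / violNorm P c (z s) with hMdef
  have hpos (s) : 0 < violNorm P c (z s) := (violNorm_nonneg _).lt_of_ne' (hz2 s)
  have hsum (s) : ∑ i, M s i ^ 2 = 1 := by
    simp only [hMdef, div_pow]
    rw [← Finset.sum_div, violNorm, Real.sq_sqrt (by positivity), div_self]
    intro h
    exact hz2 s (by rw [violNorm, h, Real.sqrt_zero])
  have hbdd (s) : M s ∈ closedBall (0 : ι → ℝ) 1 := by
    rw [mem_closedBall_zero_iff, pi_norm_le_iff_of_nonneg zero_le_one]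
    intro i
    have := Finset.single_le_sum (f := fun i => M s i ^ 2) (fun i _ => sq_nonneg _)
      (Finset.mem_univ i)
    rw [hsum] at this
    exact (sq_le_one_iff_abs_le_one _).1 this
  obtain ⟨N, -, ψ, hψ, hlim⟩ := (isCompact_closedBall (0 : ι → ℝ) 1).tendsto_subseq hbdd
  have hlim' (i) : Tendsto (fun s => M (ψ s) i) atTop (𝓝 (N i)) := tendsto_pi_nhds.1 hlim i
  have hzero := tendsto_one_div_add_atTop_nhds_zero_nat (𝕜 := ℝ)
  have hzlim : Tendsto z atTop (𝓝 xb) := tendsto_iff_norm_sub_tendsto_zero.2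
    (squeeze_zero (fun _ => norm_nonneg _) hz1 (by simpa using hzero.const_mul 2))
  have hzψ := hzlim.comp hψ.tendsto_atTop
  have hsign : ∀ᶠ s in atTop, ∀ i, N i ≠ 0 → 0 < N i * M (ψ s) i := by
    rw [eventually_all]
    intro i
    by_cases hi : N i = 0
    · simp [hi]
    · have : Tendsto (fun s => N i * M (ψ s) i) atTop (𝓝 (N i * N i)) := (hlim' i).const_mul _
      filter_upwards [this.eventually_const_lt (mul_self_pos.2 hi)] with s hs _ using hs
  obtain ⟨s₀, hs₀⟩ := eventually_atTop.1 hsign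
  have hN : N = 0 := by
    refine hqn N (fun i hi => ge_of_tendsto' (hlim' i) fun s =>
      div_nonneg (viol_nonneg hi _) (violNorm_nonneg _)) ?_
      ⟨fun s => z (ψ (s + s₀)), hzψ.comp (tendsto_add_atTop_nat s₀), fun s i hi => ?_⟩
    · have h1 : Tendsto (fun s => ∑ i, M (ψ s) i • fderiv ℝ (c i) (z (ψ s))) atTop
          (𝓝 (∑ i, N i • fderiv ℝ (c i) xb)) :=
        tendsto_finsetSum _ fun i _ => (hlim' i).smul
          ((((hc i).continuous_fderiv one_ne_zero).tendsto xb).comp hzψ)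
      have h2 : Tendsto (fun s => ∑ i, M s i • fderiv ℝ (c i) (z s)) atTop (𝓝 0) :=
        squeeze_zero_norm hz3 hzero
      exact tendsto_nhds_unique h1 (h2.comp hψ.tendsto_atTop)
    · have h1 := hs₀ (s + s₀) (Nat.le_add_left _ _) i hi
      have h2 : viol (P i) (c i (z (ψ (s + s₀)))) ≠ 0 := fun h => by simp [hMdef, h] at h1
      have h3 := viol_mul_pos h2
      have h4 : 0 < M (ψ (s + s₀)) i * c i (z (ψ (s + s₀))) := by
        simp only [hMdef]
        rw [div_mul_eq_mul_div]
        exact div_pos h3 (hpos _)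
      have h5 := mul_pos h1 h4
      have h6 : N i * M (ψ (s + s₀)) i * (M (ψ (s + s₀)) i * c i (z (ψ (s + s₀)))) =
        (M (ψ (s + s₀)) i) ^ 2 * (N i * c i (z (ψ (s + s₀)))) := by ring
      rw [h6] at h5
      exact pos_of_mul_pos_right h5 (sq_nonneg _)
  have h1 : Tendsto (fun s => ∑ i, M (ψ s) i ^ 2) atTop (𝓝 (∑ i, N i ^ 2)) :=
    tendsto_finsetSum _ fun i _ => (hlim' i).pow 2
  simp only [hsum, hN] at h1
  simpa using tendsto_nhds_unique h1 tendsto_const_nhds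
end ViolNorm

/-- The members of the family `f` with index outside `A` are replaced by `0`. -/
def restrictFamily {α : Type*} (A : Set α) (f : α → Vec n → ℝ) (a : α) : Vec n → ℝ :=
  open scoped Classical in if a ∈ A then f a else 0

theorem contDiff_restrictFamily {α : Type*} {A : Set α} {f : α → Vec n → ℝ}
    (hf : ∀ a, ContDiff ℝ 2 (f a)) (a : α) : ContDiff ℝ 2 (restrictFamily A f a) := by
  unfold restrictFamily
  split_ifs
  · exact hf a
  · exact contDiff_const

/-- The constraint functions of a branch as a single family. -/
def branchFamily (g : Fin m → Vec n → ℝ) (h : Fin p → Vec n → ℝ) (G H : Fin l → Vec n → ℝ)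
    (A : Set (Fin m)) (I J : Set (Fin l)) : Fin m ⊕ Fin p ⊕ Fin l ⊕ Fin l → Vec n → ℝ :=
  Sum.elim (restrictFamily A g)
    (Sum.elim h (Sum.elim (restrictFamily I G) (restrictFamily J H)))

section Branch

variable {g : Fin m → Vec n → ℝ} {h : Fin p → Vec n → ℝ} {G H : Fin l → Vec n → ℝ}
  {A : Set (Fin m)} {I J : Set (Fin l)}

theorem contDiff_branchFamily (hg : ∀ i, ContDiff ℝ 2 (g i)) (hh : ∀ j, ContDiff ℝ 2 (h j))
    (hG : ∀ k, ContDiff ℝ 2 (G k)) (hH : ∀ k, ContDiff ℝ 2 (H k)) :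
    ∀ i, ContDiff ℝ 2 (branchFamily g h G H A I J i)
  | .inl i => contDiff_restrictFamily hg i
  | .inr (.inl j) => hh j
  | .inr (.inr (.inl k)) => contDiff_restrictFamily hG k
  | .inr (.inr (.inr k)) => contDiff_restrictFamily hH k

theorem smul_restrictFamily {α W : Type*} [AddCommGroup W] [Module ℝ W] {S : Set α}
    {f : α → Vec n → ℝ} {w : α → ℝ} (hw : ∀ a, a ∉ S → w a = 0) (T : (Vec n → ℝ) → W) (a : α) :
    w a • T (restrictFamily S f a) = w a • T (f a) := by
  by_cases ha : a ∈ S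
  · simp [restrictFamily, ha]
  · simp [hw a ha]

theorem sum_smul_branchFamily {W : Type*} [AddCommGroup W] [Module ℝ W]
    {M : Fin m ⊕ Fin p ⊕ Fin l ⊕ Fin l → ℝ} (hA : ∀ i, i ∉ A → M (.inl i) = 0)
    (hI : ∀ k, k ∉ I → M (.inr (.inr (.inl k))) = 0)
    (hJ : ∀ k, k ∉ J → M (.inr (.inr (.inr k))) = 0) (T : (Vec n → ℝ) → W) :
    ∑ i, M i • T (branchFamily g h G H A I J i) =
      ∑ i, M (.inl i) • T (g i) + ∑ j, M (.inr (.inl j)) • T (h j) +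
        ∑ k, M (.inr (.inr (.inl k))) • T (G k) + ∑ k, M (.inr (.inr (.inr k))) • T (H k) := by
  simp only [Fintype.sum_sum_type, branchFamily, Sum.elim_inl, Sum.elim_inr, add_assoc]
  congr 1
  · exact Finset.sum_congr rfl fun i _ => smul_restrictFamily hA T i
  congr 2
  · exact Finset.sum_congr rfl fun k _ => smul_restrictFamily hI T k
  · exact Finset.sum_congr rfl fun k _ => smul_restrictFamily hJ T k

theorem gradient_zero_fun (x : Vec n) : gradient (0 : Vec n → ℝ) x = 0 := by
  simp [gradient]

theorem gradRank_eq_finrank_span_branchFamily (x : Vec n) :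
    gradRank g h G H A I J x = Module.finrank ℝ
      (Submodule.span ℝ (range fun i => gradient (branchFamily g h G H A I J i) x)) := by
  have hmem {α : Type} (S : Set α) (f : α → Vec n → ℝ) (U : Submodule ℝ (Vec n))
      (hU : ∀ a ∈ S, gradient (f a) x ∈ U) (a : α) : gradient (restrictFamily S f a) x ∈ U := by
    by_cases ha : a ∈ S
    · simpa [restrictFamily, ha] using hU a ha
    · simp [restrictFamily, ha, gradient_zero_fun]
  have hres {α : Type} {S : Set α} (f : α → Vec n → ℝ) {a : α} (ha : a ∈ S) :
      restrictFamily S f a = f a := by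
    simp [restrictFamily, ha]
  refine congrArg (fun U : Submodule ℝ (Vec n) => Module.finrank ℝ U)
    (le_antisymm (Submodule.span_le.2 ?_) (Submodule.span_le.2 ?_))
  · rintro _ (((⟨i, hi, rfl⟩ | ⟨j, rfl⟩) | ⟨k, hk, rfl⟩) | ⟨k, hk, rfl⟩)
    · exact Submodule.subset_span ⟨.inl i, by simp [branchFamily, hres g hi]⟩
    · exact Submodule.subset_span ⟨.inr (.inl j), by simp [branchFamily]⟩
    · exact Submodule.subset_span ⟨.inr (.inr (.inl k)), by simp [branchFamily, hres G hk]⟩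
    · exact Submodule.subset_span ⟨.inr (.inr (.inr k)), by simp [branchFamily, hres H hk]⟩
  · rintro _ ⟨i | j | k | k, rfl⟩
    · exact hmem A g _ (fun a ha => Submodule.subset_span (.inl (.inl (.inl ⟨a, ha, rfl⟩)))) i
    · exact Submodule.subset_span (.inl (.inl (.inr ⟨j, rfl⟩)))
    · exact hmem I G _ (fun a ha => Submodule.subset_span (.inl (.inr ⟨a, ha, rfl⟩))) k
    · exact hmem J H _ (fun a ha => Submodule.subset_span (.inr ⟨a, ha, rfl⟩)) k

theorem sum_smul_gradient {ι : Type*} [Fintype ι] (c : ι → Vec n → ℝ) (M : ι → ℝ) (x : Vec n) :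
    ∑ i, M i • gradient (c i) x =
      (InnerProductSpace.toDual ℝ (Vec n)).symm (∑ i, M i • fderiv ℝ (c i) x) := by
  simp [gradient, map_sum]

/-- Under constant rank, a linear dependence of the gradients annihilates the corresponding
combination of Hessians on the common kernel. -/
theorem sum_hessForm_eq_zero {ι : Type*} [Fintype ι] {c : ι → Vec n → ℝ}
    (hc : ∀ i, ContDiff ℝ 2 (c i)) {x d : Vec n}
    (hrank : ∀ᶠ y in 𝓝 x, Module.finrank ℝ (Submodule.span ℝ (range fun i => gradient (c i) y)) =
      Module.finrank ℝ (Submodule.span ℝ (range fun i => gradient (c i) x)))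
    {M : ι → ℝ} (hM : ∑ i, M i • gradient (c i) x = 0) (hd : ∀ i, fderiv ℝ (c i) x d = 0) :
    ∑ i, M i * hessForm (c i) x d = 0 := by
  have hline : HasDerivAt (fun t : ℝ => x + t • d) d 0 := by
    simpa using ((hasDerivAt_id (0 : ℝ)).smul_const d).const_add x
  have hderiv (i) : HasDerivAt (fun t : ℝ => gradient (c i) (x + t • d))
      ((InnerProductSpace.toDual ℝ (Vec n)).symm (fderiv ℝ (fderiv ℝ (c i)) x d)) 0 := by
    have h1 : HasFDerivAt (fderiv ℝ (c i)) (fderiv ℝ (fderiv ℝ (c i)) x) (x + (0 : ℝ) • d) := by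
      rw [zero_smul, add_zero]
      exact (((hc i).fderiv_right (m := 1) (by norm_num)).differentiable one_ne_zero x).hasFDerivAt
    exact ((InnerProductSpace.toDual ℝ (Vec n)).symm.toContinuousLinearEquiv
      |>.toContinuousLinearMap.hasFDerivAt.comp_hasDerivAt 0 (h1.comp_hasDerivAt 0 hline))
  have hlim : Tendsto (fun t : ℝ => x + t • d) (𝓝 0) (𝓝 x) := by
    simpa using hline.continuousAt.tendsto
  have hinner (φ : StrongDual ℝ (Vec n)) :
      innerSL ℝ d ((InnerProductSpace.toDual ℝ (Vec n)).symm φ) = φ d := by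
    rw [innerSL_apply_apply, real_inner_comm, InnerProductSpace.toDual_symm_apply]
  have := apply_sum_deriv_eq_zero_of_finrank_const hderiv
    (by
      beta_reduce
      rw [zero_smul, add_zero]
      exact hlim.eventually hrank)
    (M := M) (by simpa using hM) (φ := innerSL ℝ d)
    (fun i => by simpa [gradient, hinner] using hd i)
  simpa only [hessForm, iteratedFDeriv_two_apply, hinner, Matrix.cons_val_zero,
    Matrix.cons_val_one] using this

theorem branch_error_bound (hg : ∀ i, ContDiff ℝ 2 (g i)) (hh : ∀ j, ContDiff ℝ 2 (h j))
    (hG : ∀ k, ContDiff ℝ 2 (G k)) (hH : ∀ k, ContDiff ℝ 2 (H k))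
    {xb : Vec n} (hxb : xb ∈ Feas g h G H) (hpwcr : PWCR g h G H xb) (hqn : PSOQN g h G H xb)
    {β1 β2 : Set (Fin l)} (hβ : Partition G H xb β1 β2)
    (hfeas : violNorm (fun i => i.isLeft = true)
      (branchFamily g h G H univ (IG G H xb ∪ β1) (IH G H xb ∪ β2)) xb = 0) :
    ∃ K > 0, ∀ᶠ x in 𝓝 xb, infDist x {y | violNorm (fun i => i.isLeft = true)
        (branchFamily g h G H univ (IG G H xb ∪ β1) (IH G H xb ∪ β2)) y = 0} ≤
      K * violNorm (fun i => i.isLeft = true)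
        (branchFamily g h G H univ (IG G H xb ∪ β1) (IH G H xb ∪ β2)) x := by
  refine exists_error_bound_of_quasinormal
    (fun i => (contDiff_branchFamily hg hh hG hH i).of_le one_le_two) hfeas ?_
  rintro M hnonneg hsum ⟨xs, hxs, hpos⟩
  have hpos' {α : Type} {S : Set α} {f : α → Vec n → ℝ} {a : α} {w : ℝ}
      (hw : w ≠ 0 → 0 < w * restrictFamily S f a (xs 0)) (ha : a ∉ S) : w = 0 := by
    by_contra hne
    simpa [restrictFamily, ha] using hw hne
  have hI (k) (hk : k ∉ IG G H xb ∪ β1) : M (.inr (.inr (.inl k))) = 0 :=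
    hpos' (hpos 0 (.inr (.inr (.inl k)))) hk
  have hJ (k) (hk : k ∉ IH G H xb ∪ β2) : M (.inr (.inr (.inr k))) = 0 :=
    hpos' (hpos 0 (.inr (.inr (.inr k)))) hk
  have hgpos (s i) (hi : M (.inl i) ≠ 0) : 0 < M (.inl i) * g i (xs s) := by
    simpa [branchFamily, restrictFamily] using hpos s (.inl i) hi
  have hGpos (s k) (hk : M (.inr (.inr (.inl k))) ≠ 0) :
      0 < M (.inr (.inr (.inl k))) * G k (xs s) := by
    have hk' := not_imp_comm.1 (hI k) hk
    simpa [branchFamily, restrictFamily, if_pos hk'] using hpos s _ hk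
  have hHpos (s k) (hk : M (.inr (.inr (.inr k))) ≠ 0) :
      0 < M (.inr (.inr (.inr k))) * H k (xs s) := by
    have hk' := not_imp_comm.1 (hJ k) hk
    simpa [branchFamily, restrictFamily, if_pos hk'] using hpos s _ hk
  have hA (i) (hi : i ∉ Ig g xb) : M (.inl i) = 0 := by
    by_contra hne
    refine hi (le_antisymm (hxb.1 i) ?_)
    exact ge_of_tendsto' (((hg i).continuous.tendsto xb).comp hxs) fun s =>
      (pos_of_mul_pos_right (hgpos s i hne) (hnonneg _ rfl)).le
  have hgrad : ∑ i, M i • gradient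
      (branchFamily g h G H univ (IG G H xb ∪ β1) (IH G H xb ∪ β2) i) xb = 0 := by
    rw [sum_smul_gradient, hsum, map_zero]
  have hgrad' := (sum_smul_branchFamily (g := g) (h := h) (G := G) (H := H) (A := univ)
    (fun i hi => absurd (mem_univ i) hi) hI hJ (gradient · xb)).symm.trans hgrad
  by_contra hM
  refine hqn β1 β2 hβ ⟨fun i => M (.inl i), fun j => M (.inr (.inl j)),
    fun k => M (.inr (.inr (.inl k))), fun k => M (.inr (.inr (.inr k))),
    fun i => hnonneg _ rfl, hI, hJ, fun ⟨h1, h2, h3, h4⟩ => hM ?_, hgrad', ?_, xs, hxs, fun s =>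
    ⟨fun i hi => hgpos s i hi.ne', fun j => hpos s (.inr (.inl j)), hGpos s, hHpos s⟩⟩
  · funext i
    rcases i with i | j | k | k
    · exact congrFun h1 i
    · exact congrFun h2 j
    · exact congrFun h3 k
    · exact congrFun h4 k
  · intro d hdg hdh hdG hdH
    obtain ⟨ε, hε, hr⟩ := hpwcr β1 β2 hβ
    have hker {α : Type} {S : Set α} {f : α → Vec n → ℝ} (hS : ∀ a ∈ S, fderiv ℝ (f a) xb d = 0)
        (a : α) : fderiv ℝ (restrictFamily S f a) xb d = 0 := by
      by_cases ha : a ∈ S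
      · simpa [restrictFamily, ha] using hS a ha
      · simp [restrictFamily, ha]
    have := sum_hessForm_eq_zero (c := branchFamily g h G H (Ig g xb) (IG G H xb ∪ β1)
      (IH G H xb ∪ β2)) (contDiff_branchFamily hg hh hG hH) (x := xb) (d := d) (M := M)
      (by
        filter_upwards [ball_mem_nhds xb hε] with x hx
        rw [mem_ball, dist_eq_norm] at hx
        simpa only [gradRank_eq_finrank_span_branchFamily] using hr x hx)
      ((sum_smul_branchFamily hA hI hJ (gradient · xb)).trans hgrad')
      (by
        rintro (i | j | k | k)
        · exact hker hdg i
        · exact hdh j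
        · exact hker hdG k
        · exact hker hdH k)
    exact ((sum_smul_branchFamily hA hI hJ (hessForm · xb d)).symm.trans this).ge

theorem violNorm_branchFamily (x : Vec n) :
    violNorm (fun i => i.isLeft = true) (branchFamily g h G H univ I J) x =
      √(∑ i, max (g i x) 0 ^ 2 + ∑ j, h j x ^ 2 +
        ∑ k, (restrictFamily I G k x ^ 2 + restrictFamily J H k x ^ 2)) := by
  simp [violNorm, viol, Fintype.sum_sum_type, branchFamily, restrictFamily,
    Finset.sum_add_distrib, add_assoc]

theorem mem_feas_of_violNorm_eq_zero {x : Vec n} (hIJ : ∀ k, k ∈ I ∨ k ∈ J)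
    (hx : violNorm (fun i => i.isLeft = true) (branchFamily g h G H univ I J) x = 0) :
    x ∈ Feas g h G H := by
  rw [violNorm_eq_zero_iff] at hx
  refine ⟨fun i => ?_, fun j => by simpa [viol, branchFamily] using hx (.inr (.inl j)), fun k => ?_⟩
  · simpa [viol, branchFamily, restrictFamily] using hx (.inl i)
  · rcases hIJ k with hk | hk
    · have : restrictFamily I G k x = 0 := hx (.inr (.inr (.inl k)))
      rw [restrictFamily, if_pos hk] at this
      simp [this]
    · have : restrictFamily J H k x = 0 := hx (.inr (.inr (.inr k)))
      rw [restrictFamily, if_pos hk] at this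
      simp [this]

theorem violNorm_eq_zero_of_mem_feas {x : Vec n} (hx : x ∈ Feas g h G H)
    (hI : ∀ k ∈ I, G k x = 0) (hJ : ∀ k ∈ J, H k x = 0) :
    violNorm (fun i => i.isLeft = true) (branchFamily g h G H univ I J) x = 0 := by
  rw [violNorm_eq_zero_iff]
  rintro (i | j | k | k)
  · simpa [viol, branchFamily, restrictFamily] using hx.1 i
  · simpa [viol, branchFamily] using hx.2.1 j
  · by_cases hk : k ∈ I <;> simp [viol, branchFamily, restrictFamily, hk, hI]
  · by_cases hk : k ∈ J <;> simp [viol, branchFamily, restrictFamily, hk, hJ]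

theorem violNorm_le_residual {x : Vec n} (hIJ : ∀ k, k ∈ I → k ∉ J)
    (hI : ∀ k ∈ I, G k x ^ 2 ≤ H k x ^ 2) (hJ : ∀ k ∈ J, H k x ^ 2 ≤ G k x ^ 2) :
    violNorm (fun i => i.isLeft = true) (branchFamily g h G H univ I J) x ≤
      residual g h G H x := by
  rw [violNorm_branchFamily, residual]
  gcongr with k
  by_cases hk : k ∈ I
  · simp [restrictFamily, hk, hIJ k hk, hI k hk]
  · by_cases hk' : k ∈ J
    · simp [restrictFamily, hk, hk', hJ k hk']
    · simp [restrictFamily, hk, hk', sq_nonneg]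

end Branch

theorem eventually_sq_le_sq {φ ψ : Vec n → ℝ} {x : Vec n} (hφ : Continuous φ) (hψ : Continuous ψ)
    (h0 : φ x = 0) (h1 : ψ x ≠ 0) : ∀ᶠ y in 𝓝 x, φ y ^ 2 ≤ ψ y ^ 2 :=
  (((hφ.pow 2).tendsto x).eventually_lt ((hψ.pow 2).tendsto x)
    (by simpa [h0] using sq_pos_of_ne_zero h1)).mono fun _ => le_of_lt

theorem pwcr_psoqn_implies_error_bound {n m p l : ℕ} (f : Vec n → ℝ) (g : Fin m → Vec n → ℝ)
    (h : Fin p → Vec n → ℝ) (G H : Fin l → Vec n → ℝ)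
    (hf : ContDiff ℝ 2 f) (hg : ∀ i, ContDiff ℝ 2 (g i)) (hh : ∀ j, ContDiff ℝ 2 (h j))
    (hG : ∀ k, ContDiff ℝ 2 (G k)) (hH : ∀ k, ContDiff ℝ 2 (H k))
    (xb : Vec n) (hxb : xb ∈ Feas g h G H)
    (hpwcr : PWCR g h G H xb) (hqn : PSOQN g h G H xb) :
    ∃ ε > (0:ℝ), ∃ α > (0:ℝ), ∀ x : Vec n, ‖x - xb‖ < ε →
      Metric.infDist x (Feas g h G H) ≤ α * residual g h G H x := by
  have hpart (S : Set (Fin l)) : Partition G H xb (IGH G H xb ∩ S) (IGH G H xb \ S) :=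
    ⟨by grind, inter_union_sdiff _ _⟩
  have hzero (S : Set (Fin l)) := violNorm_eq_zero_of_mem_feas
    (I := IG G H xb ∪ IGH G H xb ∩ S) (J := IH G H xb ∪ IGH G H xb \ S) hxb
    (by rintro k (hk | hk); exacts [hk.1, hk.1.1]) (by rintro k (hk | hk); exacts [hk.2, hk.1.2])
  choose K hK hKbound using fun S : Set (Fin l) =>
    branch_error_bound hg hh hG hH hxb hpwcr hqn (hpart S) (hzero S)
  have hIG : ∀ᶠ x in 𝓝 xb, ∀ k, k ∈ IG G H xb → G k x ^ 2 ≤ H k x ^ 2 := by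
    rw [eventually_all]
    intro k
    rw [eventually_imp_distrib_left]
    exact fun hk => eventually_sq_le_sq (hG k).continuous (hH k).continuous hk.1 hk.2
  have hIH : ∀ᶠ x in 𝓝 xb, ∀ k, k ∈ IH G H xb → H k x ^ 2 ≤ G k x ^ 2 := by
    rw [eventually_all]
    intro k
    rw [eventually_imp_distrib_left]
    exact fun hk => eventually_sq_le_sq (hH k).continuous (hG k).continuous hk.2 hk.1
  obtain ⟨ε, hε, hball⟩ := Metric.eventually_nhds_iff.1
    ((eventually_all.2 hKbound).and (hIG.and hIH))
  have hKsum (S : Set (Fin l)) : K S ≤ ∑ S, K S :=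
    Finset.single_le_sum (fun S _ => (hK S).le) (Finset.mem_univ S)
  refine ⟨ε, hε, ∑ S, K S, (hK ∅).trans_le (hKsum ∅), fun x hx => ?_⟩
  obtain ⟨hbound, hG', hH'⟩ := hball (by rwa [dist_eq_norm])
  set S : Set (Fin l) := {k | G k x ^ 2 ≤ H k x ^ 2} with hS
  have hcover (k) : k ∈ IG G H xb ∪ IGH G H xb ∩ S ∨ k ∈ IH G H xb ∪ IGH G H xb \ S := by
    have := mul_eq_zero.1 (hxb.2.2 k)
    simp only [IG, IH, IGH, mem_union, mem_inter_iff, Set.mem_sdiff, mem_ofPred_eq]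
    tauto
  calc infDist x (Feas g h G H)
      ≤ infDist x {y | violNorm (fun i => i.isLeft = true) (branchFamily g h G H univ
          (IG G H xb ∪ IGH G H xb ∩ S) (IH G H xb ∪ IGH G H xb \ S)) y = 0} :=
        infDist_le_infDist_of_subset (fun y hy => mem_feas_of_violNorm_eq_zero hcover hy)
          ⟨xb, hzero S⟩
    _ ≤ K S * violNorm (fun i => i.isLeft = true) (branchFamily g h G H univ
          (IG G H xb ∪ IGH G H xb ∩ S) (IH G H xb ∪ IGH G H xb \ S)) x := hbound S
    _ ≤ K S * residual g h G H x := by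
        refine mul_le_mul_of_nonneg_left (violNorm_le_residual ?_ ?_ ?_) (hK S).le
        · simp only [IG, IH, IGH, mem_union, mem_inter_iff, Set.mem_sdiff, mem_ofPred_eq]
          tauto
        · rintro k (hk | hk)
          exacts [hG' k hk, hk.2]
        · rintro k (hk | hk)
          exacts [hH' k hk, (not_le.1 hk.2).le]
    _ ≤ (∑ S, K S) * residual g h G H x :=
        mul_le_mul_of_nonneg_right (hKsum S) (Real.sqrt_nonneg _)

end MPSC
end
end
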